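/- Suppose z ∈ ran( ∂f + Σ_{i=1}^m L_i*((K_i* ∘ ∂g_i ∘ K_i) □ (M_i* ∘ ∂l_i ∘ M_i))(L_i · − r_i) + ∇h ) and the step sizes satisfy 2μ⁻¹(1−ᾱ) min_{i=1,…,m}{1/τ, 1/θ_{1,i}, 1/θ_{2,i}, 1/γ_{1,i}, 1/γ_{2,i}, 1/σ_i} > 1 with ᾱ = max{ √(τ Σ_i σ_i‖L_i‖²), max_j √(θ_{1,j}γ_{1,j}‖K_j‖²), max_j √(θ_{2,j}γ_{2,j}‖M_j‖²) }. Then for the sequences generated by Algorithm 4.3 there exist an optimal solution x̄ to the primal problem (P) and an optimal solution (p̄, q̄) to the dual problem (D) such that x_n ⇀ x̄ weakly in H and, for every i = 1,…,m, p_{i,n} ⇀ p̄_i weakly in X_i and q_{i,n} ⇀ q̄_i weakly in Y_i as n → +∞. -/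

import Mathlib

open scoped RealInnerProductSpace ENNReal
open Filter Topology

noncomputable section

/-- `f ∈ Γ(E)`: proper, convex and lower semicontinuous -/
def ProperConvLsc {E : Type*} [NormedAddCommGroup E] [InnerProductSpace ℝ E]
    (f : E → EReal) : Prop :=
  (∃ x, f x ≠ ⊤) ∧ (∀ x, f x ≠ ⊥) ∧
  (∀ x y : E, ∀ a b : ℝ, 0 ≤ a → 0 ≤ b → a + b = 1 →
    f (a • x + b • y) ≤ (a : EReal) * f x + (b : EReal) * f y) ∧
  LowerSemicontinuous f

/-- Fenchel conjugate -/
def econj {E : Type*} [NormedAddCommGroup E] [InnerProductSpace ℝ E]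
    (f : E → EReal) (p : E) : EReal :=
  ⨆ x : E, ((⟪p, x⟫ : ℝ) : EReal) - f x

/-- infimal convolution -/
def einfConv {E : Type*} [AddGroup E] (f g : E → EReal) (x : E) : EReal :=
  ⨅ y : E, f y + g (x - y)

/-- convex subdifferential -/
def esubdiff {E : Type*} [NormedAddCommGroup E] [InnerProductSpace ℝ E]
    (f : E → EReal) (x : E) : Set E :=
  {p | f x ≠ ⊤ ∧ f x ≠ ⊥ ∧ ∀ y, f x + ((⟪p, y - x⟫ : ℝ) : EReal) ≤ f y}

/-- effective domain -/
def edom {E : Type*} (f : E → EReal) : Set E := {x | f x ≠ ⊤}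

def invOp {E : Type*} (A : E → Set E) : E → Set E := fun u => {x | u ∈ A x}

def sumOp {E : Type*} [Add E] (A B : E → Set E) : E → Set E :=
  fun x => {s | ∃ u ∈ A x, ∃ v ∈ B x, s = u + v}

/-- parallel sum `A □ B = (A⁻¹ + B⁻¹)⁻¹` -/
def parOp {E : Type*} [Add E] (A B : E → Set E) : E → Set E :=
  invOp (sumOp (invOp A) (invOp B))

/-- `T* ∘ B ∘ T` -/
def compOp {F G : Type*} [NormedAddCommGroup F] [InnerProductSpace ℝ F] [CompleteSpace F]
    [NormedAddCommGroup G] [InnerProductSpace ℝ G] [CompleteSpace G]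
    (T : F →L[ℝ] G) (B : G → Set G) : F → Set F :=
  fun x => (ContinuousLinearMap.adjoint T) '' (B (T x))

/-- `x = Prox_{γ f}(w)`: `x` minimizes `u ↦ γ f(u) + ‖u - w‖²/2` -/
def IsProx {E : Type*} [NormedAddCommGroup E] [InnerProductSpace ℝ E]
    (γ : ℝ) (f : E → EReal) (w x : E) : Prop :=
  ∀ u : E, (γ : EReal) * f x + ((‖x - w‖ ^ 2 / 2 : ℝ) : EReal) ≤
    (γ : EReal) * f u + ((‖u - w‖ ^ 2 / 2 : ℝ) : EReal)

/-- weak convergence in a Hilbert space -/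
def WConv {E : Type*} [NormedAddCommGroup E] [InnerProductSpace ℝ E] (u : ℕ → E) (l : E) : Prop :=
  ∀ w : E, Tendsto (fun n => ⟪u n, w⟫) atTop (𝓝 ⟪l, w⟫)

/-- the objective value of the primal problem (P) -/
def Pval {m : ℕ}
    {H : Type*} [NormedAddCommGroup H] [InnerProductSpace ℝ H] [CompleteSpace H]
    {G : Fin m → Type*} [∀ i, NormedAddCommGroup (G i)] [∀ i, InnerProductSpace ℝ (G i)]
    [∀ i, CompleteSpace (G i)]
    {X : Fin m → Type*} [∀ i, NormedAddCommGroup (X i)] [∀ i, InnerProductSpace ℝ (X i)]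
    [∀ i, CompleteSpace (X i)]
    {Y : Fin m → Type*} [∀ i, NormedAddCommGroup (Y i)] [∀ i, InnerProductSpace ℝ (Y i)]
    [∀ i, CompleteSpace (Y i)]
    (z : H) (f : H → EReal) (h : H → ℝ)
    (g : ∀ i, X i → EReal) (l : ∀ i, Y i → EReal) (r : ∀ i, G i)
    (L : ∀ i, H →L[ℝ] G i) (K : ∀ i, G i →L[ℝ] X i) (M : ∀ i, G i →L[ℝ] Y i)
    (x : H) : EReal :=
  f x + (∑ i, einfConv (fun w => g i (K i w)) (fun w => l i (M i w)) (L i x - r i)) +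
    ((h x - ⟪x, z⟫ : ℝ) : EReal)

/-- the objective value of the dual problem (D) -/
def Dval {m : ℕ}
    {H : Type*} [NormedAddCommGroup H] [InnerProductSpace ℝ H] [CompleteSpace H]
    {G : Fin m → Type*} [∀ i, NormedAddCommGroup (G i)] [∀ i, InnerProductSpace ℝ (G i)]
    [∀ i, CompleteSpace (G i)]
    {X : Fin m → Type*} [∀ i, NormedAddCommGroup (X i)] [∀ i, InnerProductSpace ℝ (X i)]
    [∀ i, CompleteSpace (X i)]
    {Y : Fin m → Type*} [∀ i, NormedAddCommGroup (Y i)] [∀ i, InnerProductSpace ℝ (Y i)]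
    [∀ i, CompleteSpace (Y i)]
    (z : H) (f : H → EReal) (h : H → ℝ)
    (g : ∀ i, X i → EReal) (l : ∀ i, Y i → EReal) (r : ∀ i, G i)
    (L : ∀ i, H →L[ℝ] G i) (K : ∀ i, G i →L[ℝ] X i) (M : ∀ i, G i →L[ℝ] Y i)
    (p : ∀ i, X i) (q : ∀ i, Y i) : EReal :=
  - einfConv (econj f) (econj (fun x => (h x : EReal)))
      (z - ∑ i, ContinuousLinearMap.adjoint (L i) (ContinuousLinearMap.adjoint (K i) (p i)))
    - ∑ i, (econj (g i) (p i) + econj (l i) (q i) + ((⟪p i, K i (r i)⟫ : ℝ) : EReal))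


section Convex

variable {E : Type*} [NormedAddCommGroup E] [InnerProductSpace ℝ E]

/-- Convexity of an extended-real-valued function, expressed through real upper bounds. -/
def EConvex (f : E → EReal) : Prop :=
  ∀ (x y : E) (a b s t : ℝ), 0 ≤ a → 0 ≤ b → a + b = 1 → f x ≤ s → f y ≤ t →
    f (a • x + b • y) ≤ ((a * s + b * t : ℝ) : EReal)

theorem ProperConvLsc.eConvex {f : E → EReal} (hf : ProperConvLsc f) : EConvex f := by
  intro x y a b s t ha hb hab hs ht
  refine (hf.2.2.1 x y a b ha hb hab).trans ?_
  push_cast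
  exact add_le_add (mul_le_mul_of_nonneg_left hs (by exact_mod_cast ha))
    (mul_le_mul_of_nonneg_left ht (by exact_mod_cast hb))

theorem econj_le_coe_iff {f : E → EReal} (hf : ∀ x, f x ≠ ⊥) {p : E} {s : ℝ} :
    econj f p ≤ s ↔ ∀ (u : E) (t : ℝ), f u = t → ⟪p, u⟫ - t ≤ s := by
  rw [econj, iSup_le_iff]
  refine forall_congr' fun u => ?_
  specialize hf u
  induction hu : f u using EReal.rec with
  | bot => exact absurd hu hf
  | top => simp
  | coe r => simp only [EReal.coe_eq_coe_iff, forall_eq']; exact_mod_cast Iff.rfl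

theorem inner_sub_le_econj {f : E → EReal} (p u : E) :
    ((⟪p, u⟫ : ℝ) : EReal) - f u ≤ econj f p :=
  le_iSup (fun x : E => ((⟪p, x⟫ : ℝ) : EReal) - f x) u

theorem econj_ne_bot {f : E → EReal} (hf : ∃ x, f x ≠ ⊤) (p : E) : econj f p ≠ ⊥ := by
  obtain ⟨x, hx⟩ := hf
  intro h
  have h1 := inner_sub_le_econj (f := f) p x
  rw [h, le_bot_iff] at h1
  induction hu : f x using EReal.rec with
  | bot => rw [hu] at h1; simp at h1
  | top => exact hx hu
  | coe r => rw [hu] at h1; exact EReal.coe_ne_bot _ (by exact_mod_cast h1)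

theorem eConvex_econj {f : E → EReal} (hf : ∀ x, f x ≠ ⊥) : EConvex (econj f) := by
  intro x y a b s t ha hb hab hs ht
  rw [econj_le_coe_iff hf] at *
  intro u r hu
  have h1 := mul_le_mul_of_nonneg_left (hs u r hu) ha
  have h2 := mul_le_mul_of_nonneg_left (ht u r hu) hb
  rw [inner_add_left, real_inner_smul_left, real_inner_smul_left]
  have : r = a * r + b * r := by rw [← add_mul, hab, one_mul]
  linarith

/-- The epigraph of a proper convex lsc function can be strictly separated from points below. -/
theorem ProperConvLsc.exists_separation {f : E → EReal} (hf : ProperConvLsc f) {x₀ : E} {a : ℝ}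
    (ha : (a : EReal) < f x₀) :
    ∃ (ℓ : StrongDual ℝ E) (β u : ℝ), 0 ≤ β ∧ ℓ x₀ + β * a < u ∧
      ∀ (y : E) (t : ℝ), f y ≤ t → u < ℓ y + β * t := by
  have hconv : Convex ℝ {q : E × ℝ | f q.1 ≤ (q.2 : EReal)} := by
    intro q hq q' hq' b c hb hc hbc
    exact hf.eConvex q.1 q'.1 b c q.2 q'.2 hb hc hbc hq hq'
  have hclosed : IsClosed {q : E × ℝ | f q.1 ≤ (q.2 : EReal)} := by
    have h1 : IsClosed {q : E × EReal | f q.1 ≤ q.2} := hf.2.2.2.isClosed_epigraph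
    exact h1.preimage (f := fun q : E × ℝ => (q.1, (q.2 : EReal)))
      (continuous_fst.prodMk (continuous_coe_real_ereal.comp continuous_snd))
  obtain ⟨φ, u, hx, hu⟩ := geometric_hahn_banach_point_closed hconv hclosed
    (x := (x₀, a)) (by simpa using ha)
  have hφ : ∀ (y : E) (t : ℝ),
      φ (y, t) = φ.comp (ContinuousLinearMap.inl ℝ E ℝ) y + φ (0, 1) * t := by
    intro y t
    have : (y, t) = (y, (0 : ℝ)) + t • ((0 : E), (1 : ℝ)) := by simp
    rw [this, map_add, map_smul]
    simp [mul_comm]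
  have hu' : ∀ (y : E) (t : ℝ), f y ≤ t →
      u < φ.comp (ContinuousLinearMap.inl ℝ E ℝ) y + φ (0, 1) * t := by
    intro y t h
    rw [← hφ]
    exact hu (y, t) h
  refine ⟨φ.comp (ContinuousLinearMap.inl ℝ E ℝ), φ (0, 1), u, ?_, by rwa [← hφ], hu'⟩
  by_contra! hβ
  obtain ⟨y, hy⟩ := hf.1
  lift f y to ℝ using ⟨hy, hf.2.1 y⟩ with s hs
  set ℓ := φ.comp (ContinuousLinearMap.inl ℝ E ℝ)
  set β := φ (0, 1)
  have h1 := hu' y (max s ((u - ℓ y) / β)) (by rw [← hs]; exact_mod_cast le_max_left _ _)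
  have h2 := mul_le_mul_of_nonpos_left (le_max_right s ((u - ℓ y) / β)) hβ.le
  rw [mul_div_cancel₀ _ hβ.ne] at h2
  linarith

theorem ProperConvLsc.exists_affine_minorant [CompleteSpace E] {f : E → EReal}
    (hf : ProperConvLsc f) {x₀ : E} {a : ℝ} (ha : (a : EReal) < f x₀) :
    ∃ (p : E) (c : ℝ), (∀ (y : E) (t : ℝ), f y = t → ⟪p, y⟫ - t ≤ c) ∧ a < ⟪p, x₀⟫ - c := by
  have pos_case : ∀ {x₀ : E} {a : ℝ} (ℓ : StrongDual ℝ E) (β u : ℝ), 0 < β →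
      ℓ x₀ + β * a < u → (∀ (y : E) (t : ℝ), f y ≤ t → u < ℓ y + β * t) →
      ∃ (p : E) (c : ℝ), (∀ (y : E) (t : ℝ), f y = t → ⟪p, y⟫ - t ≤ c) ∧
        a < ⟪p, x₀⟫ - c := by
    intro x₀ a ℓ β u hβ h1 h2
    have hp : ∀ y, ⟪(-β⁻¹) • (InnerProductSpace.toDual ℝ E).symm ℓ, y⟫ = -(ℓ y / β) := by
      intro y
      rw [real_inner_smul_left, InnerProductSpace.toDual_symm_apply]
      ring
    refine ⟨(-β⁻¹) • (InnerProductSpace.toDual ℝ E).symm ℓ, -(u / β), ?_, ?_⟩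
    · intro y t hy
      rw [hp]
      have h3 := h2 y t hy.le
      have h4 : u / β ≤ ℓ y / β + t := by
        rw [div_add' _ _ _ hβ.ne']
        gcongr
        linarith
      linarith
    · rw [hp]
      have h4 : ℓ x₀ / β + a < u / β := by
        rw [div_add' _ _ _ hβ.ne']
        gcongr
        linarith
      linarith
  obtain ⟨ℓ, β, u, hβ, h1, h2⟩ := hf.exists_separation ha
  rcases hβ.lt_or_eq with hβ | rfl
  · exact pos_case ℓ β u hβ h1 h2
  obtain ⟨x₁, hx₁⟩ := hf.1
  have hx₁' := hf.2.1 x₁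
  lift f x₁ to ℝ using ⟨hx₁, hx₁'⟩ with s hs
  obtain ⟨ℓ', β', u', hβ', h1', h2'⟩ := hf.exists_separation (x₀ := x₁) (a := s - 1)
    (by rw [← hs]; exact_mod_cast sub_one_lt s)
  obtain ⟨p, c, hp, -⟩ := pos_case ℓ' β' u' (by nlinarith [h2' x₁ s hs.symm.le]) h1' h2'
  simp only [zero_mul, add_zero] at h1 h2
  obtain ⟨n, hn⟩ := exists_nat_gt ((a - (⟪p, x₀⟫ - c)) / (u - ℓ x₀))
  rw [div_lt_iff₀ (by linarith)] at hn
  refine ⟨p - (n : ℝ) • (InnerProductSpace.toDual ℝ E).symm ℓ, c - n * u, ?_, ?_⟩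
  · intro y t hy
    rw [inner_sub_left, real_inner_smul_left, InnerProductSpace.toDual_symm_apply]
    have := mul_le_mul_of_nonneg_left (h2 y t hy.le).le n.cast_nonneg (α := ℝ)
    linarith [hp y t hy]
  · rw [inner_sub_left, real_inner_smul_left, InnerProductSpace.toDual_symm_apply]
    linarith

/-- The nontrivial half of the Fenchel–Moreau theorem. -/
theorem ProperConvLsc.le_econj_econj [CompleteSpace E] {f : E → EReal} (hf : ProperConvLsc f)
    (x : E) : f x ≤ econj (econj f) x := by
  refine EReal.ge_of_forall_gt_iff_ge.1 fun a ha => ?_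
  obtain ⟨p, c, hp, hc⟩ := hf.exists_affine_minorant ha
  have h1 : econj f p ≤ c := (econj_le_coe_iff hf.2.1).2 hp
  have h2 := inner_sub_le_econj (f := econj f) x p
  refine le_trans ?_ h2
  rw [real_inner_comm]
  refine le_trans ?_ (EReal.sub_le_sub le_rfl h1)
  exact_mod_cast hc.le

theorem ProperConvLsc.exists_econj_ne_top [CompleteSpace E] {f : E → EReal}
    (hf : ProperConvLsc f) : ∃ p, econj f p ≠ ⊤ := by
  obtain ⟨x, hx⟩ := hf.1
  have hx' := hf.2.1 x
  obtain ⟨a, -, ha⟩ := EReal.lt_iff_exists_real_btwn.1 (bot_lt_iff_ne_bot.2 hx')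
  obtain ⟨p, c, hp, -⟩ := hf.exists_affine_minorant ha
  exact ⟨p, ((econj_le_coe_iff hf.2.1).2 hp |>.trans_lt (EReal.coe_lt_top c)).ne⟩

theorem econj_eq_of_mem_esubdiff {f : E → EReal} {x p : E} (hp : p ∈ esubdiff f x) :
    econj f p = ((⟪p, x⟫ : ℝ) : EReal) - f x := by
  obtain ⟨h1, h2, h3⟩ := hp
  refine le_antisymm (iSup_le fun u => ?_) (inner_sub_le_econj p x)
  have h4 := h3 u
  lift f x to ℝ using ⟨h1, h2⟩ with s hs
  induction hu : f u using EReal.rec with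
  | bot => rw [hu] at h4; exact absurd h4 (by rw [le_bot_iff]; exact_mod_cast EReal.coe_ne_bot _)
  | top => simp
  | coe r =>
    rw [hu, inner_sub_right] at h4
    norm_cast at *
    linarith

theorem mem_esubdiff_econj {f : E → EReal} {x p : E} (hp : p ∈ esubdiff f x) :
    x ∈ esubdiff (econj f) p := by
  have h0 := econj_eq_of_mem_esubdiff hp
  obtain ⟨h1, h2, -⟩ := hp
  have h3 : ∀ y, ((⟪y, x⟫ : ℝ) : EReal) - f x ≤ econj f y := fun y => inner_sub_le_econj y x
  lift f x to ℝ using ⟨h1, h2⟩ with s hs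
  refine ⟨?_, ?_, fun y => ?_⟩
  · rw [h0]; exact_mod_cast EReal.coe_ne_top _
  · rw [h0]; exact_mod_cast EReal.coe_ne_bot _
  · refine le_trans (le_of_eq ?_) (h3 y)
    rw [h0, inner_sub_right, real_inner_comm y x, real_inner_comm x p]
    norm_cast
    ring_nf

theorem ProperConvLsc.mem_esubdiff_of_econj [CompleteSpace E] {f : E → EReal}
    (hf : ProperConvLsc f) {x p : E} (hx : x ∈ esubdiff (econj f) p) : p ∈ esubdiff f x := by
  have h0 := econj_eq_of_mem_esubdiff hx
  obtain ⟨h1, h2, -⟩ := hx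
  have h3 := hf.le_econj_econj x
  have h4 : ∀ u, ((⟪p, u⟫ : ℝ) : EReal) - f u ≤ econj f p := fun u => inner_sub_le_econj p u
  lift econj f p to ℝ using ⟨h1, h2⟩ with s hs
  rw [h0] at h3
  have hxb := hf.2.1 x
  have hxt : f x ≠ ⊤ := (h3.trans_lt (by exact_mod_cast EReal.coe_lt_top _)).ne
  refine ⟨hxt, hxb, fun u => ?_⟩
  have h5 := h4 u
  have hub := hf.2.1 u
  lift f x to ℝ using ⟨hxt, hxb⟩ with t ht
  induction hu : f u using EReal.rec with
  | bot => exact absurd hu hub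
  | top => simp
  | coe r =>
    rw [hu] at h5
    rw [inner_sub_right]
    rw [real_inner_comm] at h3
    norm_cast at *
    linarith

/-- A proximal point satisfies its first-order optimality condition. -/
theorem IsProx.mem_esubdiff {f : E → EReal} (hf : EConvex f) (hbot : ∀ x, f x ≠ ⊥)
    (htop : ∃ x, f x ≠ ⊤) {γ : ℝ} (hγ : 0 < γ) {w x : E} (hx : IsProx γ f w x) :
    γ⁻¹ • (w - x) ∈ esubdiff f x := by
  have hxt : f x ≠ ⊤ := by
    intro h
    obtain ⟨u, hu⟩ := htop
    have h1 := hx u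
    have hub := hbot u
    lift f u to ℝ using ⟨hu, hub⟩ with s hs
    rw [h, EReal.coe_mul_top_of_pos hγ, EReal.top_add_coe, top_le_iff] at h1
    exact EReal.coe_ne_top _ (by exact_mod_cast h1)
  refine ⟨hxt, hbot x, fun y => ?_⟩
  have hxb := hbot x
  have hyb := hbot y
  induction hy : f y using EReal.rec with
  | bot => exact absurd hy hyb
  | top => simp
  | coe r =>
    have key : ∀ t : ℝ, 0 < t → t ≤ 1 → ∀ s : ℝ, f x = s →
        s + γ⁻¹ * ⟪w - x, y - x⟫ - r ≤ t * (γ⁻¹ * ‖y - x‖ ^ 2 / 2) := by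
      intro t ht ht1 s hs
      have h1 := hf x y (1 - t) t s r (by linarith) ht.le (by ring) hs.le hy.le
      have h2 := hx ((1 - t) • x + t • y)
      rw [hs] at h2
      have h3 := h2.trans (add_le_add (mul_le_mul_of_nonneg_left h1
        (by exact_mod_cast hγ.le : (0 : EReal) ≤ (γ : EReal))) le_rfl)
      norm_cast at h3
      have h4 : (1 - t) • x + t • y - w = t • (y - x) - (w - x) := by module
      rw [h4, norm_sub_sq_real (t • (y - x)), norm_smul, mul_pow, Real.norm_eq_abs, sq_abs,
        real_inner_smul_left, norm_sub_rev x w, real_inner_comm] at h3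
      have h5 : t * (γ * (s - r) + ⟪w - x, y - x⟫) ≤ t * (t * (‖y - x‖ ^ 2 / 2)) := by
        linarith
      have h6 := le_of_mul_le_mul_left h5 ht
      have h7 := mul_le_mul_of_nonneg_left h6 (inv_nonneg.2 hγ.le)
      rw [mul_add, ← mul_assoc, inv_mul_cancel₀ hγ.ne'] at h7
      linarith
    lift f x to ℝ using ⟨hxt, hxb⟩ with s hs
    rw [real_inner_smul_left]
    norm_cast
    have h8 : Tendsto (fun t : ℝ => t * (γ⁻¹ * ‖y - x‖ ^ 2 / 2)) (𝓝[>] 0) (𝓝 0) := by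
      have : Tendsto (fun t : ℝ => t * (γ⁻¹ * ‖y - x‖ ^ 2 / 2)) (𝓝 0)
          (𝓝 (0 * (γ⁻¹ * ‖y - x‖ ^ 2 / 2))) := tendsto_id.mul_const _
      rw [zero_mul] at this
      exact this.mono_left nhdsWithin_le_nhds
    have h9 : s + γ⁻¹ * ⟪w - x, y - x⟫ - r ≤ 0 := by
      refine ge_of_tendsto h8 ?_
      filter_upwards [Ioc_mem_nhdsGT (zero_lt_one' ℝ)] with t ht
      exact key t ht.1 ht.2 s rfl
    linarith

end Convex

section Gradient

variable {H : Type*} [NormedAddCommGroup H] [InnerProductSpace ℝ H] [CompleteSpace H]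

theorem hasDerivAt_comp_line {h : H → ℝ} {h' : H → H} (hgrad : ∀ x, HasGradientAt h (h' x) x)
    (x d : H) (t : ℝ) :
    HasDerivAt (fun s : ℝ => h (x + s • d)) ⟪h' (x + t • d), d⟫ t := by
  have h1 : HasDerivAt (fun s : ℝ => x + s • d) d t := by
    simpa using ((hasDerivAt_id t).smul_const d).const_add x
  have h2 := (hgrad (x + t • d)).hasFDerivAt.comp_hasDerivAt t h1
  simpa [Function.comp_def] using h2

/-- The subgradient inequality for a differentiable convex function. -/
theorem EConvex.gradient_le {h : H → ℝ} {h' : H → H} (hh : EConvex fun x => (h x : EReal))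
    (hgrad : ∀ x, HasGradientAt h (h' x) x) (x y : H) :
    h x + ⟪h' x, y - x⟫ ≤ h y := by
  have h1 := hasDerivAt_comp_line hgrad x (y - x) 0
  rw [zero_smul, add_zero] at h1
  have h2 := h1.tendsto_slope_zero_right
  have h3 : ⟪h' x, y - x⟫ ≤ h y - h x := by
    refine le_of_tendsto h2 ?_
    filter_upwards [Ioc_mem_nhdsGT (zero_lt_one' ℝ)] with t ht
    have h4 := hh x y (1 - t) t (h x) (h y) (by linarith [ht.2]) ht.1.le (by ring) le_rfl le_rfl
    replace h4 := EReal.coe_le_coe_iff.1 h4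
    have h5 : (1 - t) • x + t • y = x + (0 + t) • (y - x) := by module
    rw [h5] at h4
    rw [smul_eq_mul, zero_smul, add_zero, inv_mul_le_iff₀ ht.1]
    linarith
  linarith

/-- The descent lemma. -/
theorem le_of_lipschitz_gradient {h : H → ℝ} {h' : H → H} {μ : ℝ}
    (hgrad : ∀ x, HasGradientAt h (h' x) x) (hlip : ∀ x y : H, ‖h' x - h' y‖ ≤ μ * ‖x - y‖)
    (x y : H) : h y ≤ h x + ⟪h' x, y - x⟫ + μ / 2 * ‖y - x‖ ^ 2 := by
  set d := y - x with hd
  have hder : ∀ t : ℝ, HasDerivAt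
      (fun s : ℝ => h (x + s • d) - s * ⟪h' x, d⟫ - s ^ 2 * (μ / 2 * ‖d‖ ^ 2))
      (⟪h' (x + t • d), d⟫ - 1 * ⟪h' x, d⟫ - (2 * t) * (μ / 2 * ‖d‖ ^ 2)) t := by
    intro t
    have h1 : HasDerivAt (fun s : ℝ => s ^ 2) (2 * t) t := by simpa using hasDerivAt_pow 2 t
    exact ((hasDerivAt_comp_line hgrad x d t).sub ((hasDerivAt_id t).mul_const _)).sub
      (h1.mul_const _)
  have hanti := antitoneOn_of_deriv_nonpos (convex_Icc (0 : ℝ) 1)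
    (fun t _ => (hder t).continuousAt.continuousWithinAt)
    (fun t _ => (hder t).differentiableAt.differentiableWithinAt) (by
      intro t ht
      rw [interior_Icc] at ht
      rw [(hder t).deriv, one_mul, ← inner_sub_left]
      have h1 := real_inner_le_norm (h' (x + t • d) - h' x) d
      have h2 := hlip (x + t • d) x
      rw [add_sub_cancel_left, norm_smul, Real.norm_eq_abs, abs_of_pos ht.1] at h2
      have h3 := mul_le_mul_of_nonneg_right h2 (norm_nonneg d)
      nlinarith)
  have h1 := hanti (Set.left_mem_Icc.2 zero_le_one) (Set.right_mem_Icc.2 zero_le_one) zero_le_one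
  simp only [one_smul, zero_smul, add_zero] at h1
  rw [hd, add_sub_cancel] at h1
  rw [hd]
  linarith

/-- The Baillon–Haddad theorem: a Lipschitz gradient of a convex function is cocoercive. -/
theorem cocoercive_of_lipschitz_gradient {h : H → ℝ} {h' : H → H} {μ : ℝ} (hμ : 0 < μ)
    (hh : EConvex fun x => (h x : EReal))
    (hgrad : ∀ x, HasGradientAt h (h' x) x) (hlip : ∀ x y : H, ‖h' x - h' y‖ ≤ μ * ‖x - y‖)
    (x y : H) : μ⁻¹ * ‖h' x - h' y‖ ^ 2 ≤ ⟪h' x - h' y, x - y⟫ := by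
  have key : ∀ a b : H, h a + ⟪h' a, b - a⟫ + μ⁻¹ / 2 * ‖h' a - h' b‖ ^ 2 ≤ h b := by
    intro a b
    set g := h' b - h' a with hg
    have h1 := le_of_lipschitz_gradient hgrad hlip b (b - μ⁻¹ • g)
    have h2 := hh.gradient_le hgrad a (b - μ⁻¹ • g)
    have h3 : b - μ⁻¹ • g - b = -(μ⁻¹ • g) := by abel
    have h4 : b - μ⁻¹ • g - a = (b - a) - μ⁻¹ • g := by abel
    rw [h3, norm_neg, norm_smul, inner_neg_right, real_inner_smul_right, Real.norm_eq_abs,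
      abs_of_pos (inv_pos.2 hμ), mul_pow] at h1
    rw [h4, inner_sub_right, real_inner_smul_right] at h2
    have h5 : ⟪h' b, g⟫ - ⟪h' a, g⟫ = ‖g‖ ^ 2 := by
      rw [← inner_sub_left, ← hg, real_inner_self_eq_norm_sq]
    have h6 : μ / 2 * (μ⁻¹ ^ 2 * ‖g‖ ^ 2) = μ⁻¹ / 2 * ‖g‖ ^ 2 := by
      field_simp
    have h7 : μ⁻¹ * ⟪h' b, g⟫ = μ⁻¹ * ⟪h' a, g⟫ + μ⁻¹ * ‖g‖ ^ 2 := by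
      rw [← h5]; ring
    rw [norm_sub_rev, ← hg]
    linarith
  have h1 := key x y
  have h2 := key y x
  rw [norm_sub_rev (h' y), ] at h2
  have h3 : ⟪h' x - h' y, x - y⟫ = -⟪h' x, y - x⟫ - ⟪h' y, x - y⟫ := by
    rw [inner_sub_left, ← inner_neg_right, neg_sub]
  rw [h3]
  linarith

end Gradient

section WeakConvergence

variable {E F : Type*} [NormedAddCommGroup E] [InnerProductSpace ℝ E] [CompleteSpace E]
  [NormedAddCommGroup F] [InnerProductSpace ℝ F] [CompleteSpace F]

/-- Weak convergence of a sequence along a filter. -/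
def WeakTendsto {E : Type*} [NormedAddCommGroup E] [InnerProductSpace ℝ E]
    (u : ℕ → E) (l : Filter ℕ) (w : E) : Prop :=
  ∀ c : E, Tendsto (fun n => ⟪u n, c⟫) l (𝓝 ⟪w, c⟫)

theorem WeakTendsto.map {u : ℕ → E} {l : Filter ℕ} {w : E} (h : WeakTendsto u l w)
    (T : E →L[ℝ] F) : WeakTendsto (fun n => T (u n)) l (T w) := by
  intro c
  simpa only [← ContinuousLinearMap.adjoint_inner_right] using h (T.adjoint c)

theorem WeakTendsto.apply {u : ℕ → E} {l : Filter ℕ} {w : E} (h : WeakTendsto u l w)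
    (φ : StrongDual ℝ E) : Tendsto (fun n => φ (u n)) l (𝓝 (φ w)) := by
  have h1 := h ((InnerProductSpace.toDual ℝ E).symm φ)
  simpa only [real_inner_comm ((InnerProductSpace.toDual ℝ E).symm φ),
    InnerProductSpace.toDual_symm_apply] using h1

omit [CompleteSpace E] in
theorem WeakTendsto.of_sub {u v : ℕ → E} {l : Filter ℕ} {w : E} (h : WeakTendsto u l w)
    (huv : Tendsto (fun n => u n - v n) l (𝓝 0)) : WeakTendsto v l w := by
  intro c
  have h1 := (h c).sub (huv.inner (tendsto_const_nhds (x := c)) (𝕜 := ℝ))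
  simpa [inner_sub_left] using h1

omit [CompleteSpace E] [CompleteSpace F] in
theorem tendsto_clm_apply₂_zero {l : Filter ℕ} (B : E →L[ℝ] StrongDual ℝ F) {e : ℕ → E}
    {u : ℕ → F} {R : ℝ} (he : Tendsto e l (𝓝 0)) (hu : ∀ n, ‖u n‖ ≤ R) :
    Tendsto (fun n => B (e n) (u n)) l (𝓝 0) := by
  have h1 : Tendsto (fun n => ‖B‖ * ‖e n‖ * R) l (𝓝 0) := by
    simpa using (he.norm.const_mul ‖B‖).mul_const R
  refine squeeze_zero_norm (fun n => (B.le_opNorm₂ _ _).trans ?_) h1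
  exact mul_le_mul_of_nonneg_left (hu n) (by positivity)

/-- Bounded sequences have weak limits along ultrafilters. -/
theorem exists_weakTendsto_of_bounded (U : Ultrafilter ℕ) {u : ℕ → E} {R : ℝ}
    (hu : ∀ n, ‖u n‖ ≤ R) : ∃ w, WeakTendsto u U w := by
  have hR : 0 ≤ R := (norm_nonneg _).trans (hu 0)
  have hlim : ∀ c : E, ∃ a : ℝ, |a| ≤ R * ‖c‖ ∧ Tendsto (fun n => ⟪u n, c⟫) U (𝓝 a) := by
    intro c
    have hmem : ∀ n, ⟪u n, c⟫ ∈ Set.Icc (-(R * ‖c‖)) (R * ‖c‖) := fun n => by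
      rw [Set.mem_Icc, ← abs_le]
      exact (abs_real_inner_le_norm _ _).trans
        (mul_le_mul_of_nonneg_right (hu n) (norm_nonneg _))
    obtain ⟨a, ha, ha'⟩ := (isCompact_Icc (a := -(R * ‖c‖)) (b := R * ‖c‖)).ultrafilter_le_nhds
      (U.map fun n => ⟪u n, c⟫) (by
        rw [le_principal_iff]
        exact Filter.mem_map.2 (Filter.univ_mem' hmem))
    exact ⟨a, abs_le.2 ha, ha'⟩
  choose a ha hlim using hlim
  let φ : E →ₗ[ℝ] ℝ :=
    { toFun := a
      map_add' := fun c d => tendsto_nhds_unique (hlim (c + d)) (by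
        simpa only [inner_add_right] using (hlim c).add (hlim d))
      map_smul' := fun t c => tendsto_nhds_unique (hlim (t • c)) (by
        simpa only [real_inner_smul_right, smul_eq_mul, RingHom.id_apply] using
          (hlim c).const_mul t) }
  refine ⟨(InnerProductSpace.toDual ℝ E).symm (φ.mkContinuous R ha), fun c => ?_⟩
  rw [InnerProductSpace.toDual_symm_apply]
  exact hlim c

/-- Weak lower semicontinuity, tested along ultrafilters on `ℕ`. -/
def WeakLsc {E : Type*} [NormedAddCommGroup E] [InnerProductSpace ℝ E] (φ : E → EReal) : Prop :=
  ∀ (U : Ultrafilter ℕ) (u : ℕ → E) (w : E), WeakTendsto u U w →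
    ∀ a : EReal, Tendsto (fun n => φ (u n)) U (𝓝 a) → φ w ≤ a

omit [CompleteSpace E] in
theorem weakLsc_econj (φ : E → EReal) : WeakLsc (econj φ) := by
  intro U u w hu a ha
  refine iSup_le fun x => ?_
  have h1 : Tendsto (fun n => ((⟪u n, x⟫ : ℝ) : EReal) - φ x) U
      (𝓝 (((⟪w, x⟫ : ℝ) : EReal) - φ x)) := by
    have h2 : Tendsto (fun n => ((⟪u n, x⟫ : ℝ) : EReal)) U (𝓝 ((⟪w, x⟫ : ℝ) : EReal)) :=
      (continuous_coe_real_ereal.tendsto _).comp (hu x)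
    simp only [sub_eq_add_neg]
    exact (EReal.continuousAt_add (p := (((⟪w, x⟫ : ℝ) : EReal), -φ x)) (by simp) (by simp)).tendsto.comp
      (h2.prodMk_nhds tendsto_const_nhds)
  exact le_of_tendsto_of_tendsto' h1 ha fun n => inner_sub_le_econj _ _

theorem ProperConvLsc.weakLsc {φ : E → EReal} (hφ : ProperConvLsc φ) : WeakLsc φ := by
  intro U u w hu a ha
  refine (hφ.le_econj_econj w).trans (iSup_le fun p => ?_)
  have h1 : WeakLsc (econj (econj φ)) := weakLsc_econj _
  have h2 : ∀ v, econj (econj φ) v ≤ φ v := by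
    intro v
    refine iSup_le fun q => ?_
    have h3 := inner_sub_le_econj (f := φ) q v
    have hvb := hφ.2.1 v
    induction hv : φ v using EReal.rec with
    | bot => exact absurd hv hvb
    | top => simp
    | coe r =>
      rw [hv] at h3
      refine (EReal.sub_le_sub le_rfl h3).trans (le_of_eq ?_)
      rw [real_inner_comm]
      norm_cast
      ring_nf
  obtain ⟨b, -, hb⟩ := isCompact_univ.ultrafilter_le_nhds
    (U.map fun n => econj (econj φ) (u n)) (by simp)
  refine (le_iSup (fun p => ((⟪w, p⟫ : ℝ) : EReal) - econj φ p) p).trans ((h1 U u w hu b hb).trans ?_)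
  exact le_of_tendsto_of_tendsto' hb ha fun n => h2 _

theorem WeakLsc.comp {φ : F → EReal} (hφ : WeakLsc φ) (T : E →L[ℝ] F) :
    WeakLsc fun x => φ (T x) :=
  fun U u w hu a ha => hφ U (fun n => T (u n)) (T w) (hu.map T) a ha

omit [CompleteSpace E] in
theorem WeakLsc.add {φ ψ : E → EReal} (hφ : WeakLsc φ) (hψ : WeakLsc ψ)
    (hφb : ∀ x, φ x ≠ ⊥) (hψb : ∀ x, ψ x ≠ ⊥) : WeakLsc fun x => φ x + ψ x := by
  intro U u w hu c hc
  obtain ⟨a, -, ha⟩ := isCompact_univ.ultrafilter_le_nhds (U.map fun n => φ (u n)) (by simp)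
  obtain ⟨b, -, hb⟩ := isCompact_univ.ultrafilter_le_nhds (U.map fun n => ψ (u n)) (by simp)
  have h1 := hφ U u w hu a ha
  have h2 := hψ U u w hu b hb
  have ha' : a ≠ ⊥ := fun h => hφb w (le_bot_iff.1 (h ▸ h1))
  have hb' : b ≠ ⊥ := fun h => hψb w (le_bot_iff.1 (h ▸ h2))
  have h3 : Tendsto (fun n => φ (u n) + ψ (u n)) U (𝓝 (a + b)) :=
    (EReal.continuousAt_add (p := (a, b)) (Or.inr hb') (Or.inl ha')).tendsto.comp
      (Tendsto.prodMk_nhds ha hb)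
  rw [tendsto_nhds_unique hc h3]
  exact add_le_add h1 h2

theorem EReal.sum_ne_bot {ι : Type*} (s : Finset ι) {f : ι → EReal} (h : ∀ i, f i ≠ ⊥) :
    ∑ i ∈ s, f i ≠ ⊥ := by
  classical
  induction s using Finset.induction_on with
  | empty => simp
  | insert i s hi ih =>
    rw [Finset.sum_insert hi, Ne, EReal.add_eq_bot_iff, not_or]
    exact ⟨h i, ih⟩

omit [CompleteSpace E] in
theorem WeakLsc.sum {ι : Type*} (s : Finset ι) {φ : ι → E → EReal} (hφ : ∀ i, WeakLsc (φ i))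
    (hφb : ∀ i x, φ i x ≠ ⊥) : WeakLsc fun x => ∑ i ∈ s, φ i x := by
  classical
  induction s using Finset.induction_on with
  | empty =>
    intro U u w hu a ha
    simp only [Finset.sum_empty] at ha ⊢
    exact (tendsto_nhds_unique tendsto_const_nhds ha).le
  | insert i s hi ih =>
    simp only [Finset.sum_insert hi]
    exact (hφ i).add ih (hφb i) fun x => EReal.sum_ne_bot s fun j => hφb j x

end WeakConvergence

section ForwardBackward

theorem tendsto_of_le_add_summable {a η : ℕ → ℝ} (ha : ∀ n, 0 ≤ a n) (hη : ∀ n, 0 ≤ η n)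
    (hsum : Summable η) (h : ∀ n, a (n + 1) ≤ a n + η n) : ∃ b, Tendsto a atTop (𝓝 b) := by
  have hanti : Antitone fun n => a n - ∑ k ∈ Finset.range n, η k := by
    refine antitone_nat_of_succ_le fun n => ?_
    rw [Finset.sum_range_succ]
    linarith [h n]
  have hbdd : BddBelow (Set.range fun n => a n - ∑ k ∈ Finset.range n, η k) := by
    refine ⟨-∑' k, η k, ?_⟩
    rintro _ ⟨n, rfl⟩
    have := hsum.sum_le_tsum (Finset.range n) fun k _ => hη k
    dsimp only
    linarith [ha n]
  refine ⟨_, ((tendsto_atTop_ciInf hanti hbdd).add hsum.hasSum.tendsto_sum_nat).congr fun n => ?_⟩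
  ring

variable {E H : Type*} [NormedAddCommGroup E] [InnerProductSpace ℝ E] [CompleteSpace E]
  [NormedAddCommGroup H] [InnerProductSpace ℝ H] [CompleteSpace H]

omit [CompleteSpace E] in
theorem sqrt_form_add_le (B : E →L[ℝ] StrongDual ℝ E) (hsym : ∀ a b, B a b = B b a)
    (hpos : ∀ a, 0 ≤ B a a) (a b : E) :
    √(B (a + b) (a + b)) ≤ √(B a a) + √(B b b) := by
  have hcs : B a b ≤ √(B a a) * √(B b b) := by
    rw [← Real.sqrt_mul (hpos a)]
    refine Real.le_sqrt_of_sq_le ?_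
    have h1 : B a b * B b a ≤ B a a * B b b :=
      LinearMap.BilinForm.apply_mul_apply_le_of_forall_zero_le
        (ContinuousLinearMap.toLinearMap₁₂ B) hpos a b
    rw [hsym b a] at h1
    nlinarith
  refine Real.sqrt_le_iff.2 ⟨by positivity, ?_⟩
  simp only [map_add, add_apply, hsym b a]
  nlinarith [Real.sq_sqrt (hpos a), Real.sq_sqrt (hpos b)]

/-- `v` is the outcome of one exact forward–backward step started at `w`, for the subdifferential
of `F` plus a skew form `S` plus a linear form `c`, the cocoercive operator `C` acting through `P`,
and the metric given by the form `B`. Fixed points are the zeros of the sum of the operators. -/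
def IsFBStep (F : E → EReal) (B S : E →L[ℝ] StrongDual ℝ E) (c : StrongDual ℝ E) (P : E →L[ℝ] H)
    (C : H → H) (w v : E) : Prop :=
  F v ≠ ⊤ ∧ ∀ u, F v + ((B (w - v) (u - v) - ⟪C (P w), P (u - v)⟫ - S v u - c (u - v) : ℝ) :
    EReal) ≤ F u

variable {F : E → EReal} {B S : E →L[ℝ] StrongDual ℝ E} {c : StrongDual ℝ E} {P : E →L[ℝ] H}
  {C : H → H} {μ κ ρ : ℝ}

omit [CompleteSpace E] [CompleteSpace H] in
theorem IsFBStep.inner_le (hbot : ∀ x, F x ≠ ⊥) (hskew : ∀ a b, S a b = -S b a) {w v s : E}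
    (hv : IsFBStep F B S c P C w v) (hs : IsFBStep F B S c P C s s) :
    ⟪C (P w) - C (P s), P v - P s⟫ ≤ B (w - v) (v - s) := by
  have h1 := hv.2 s
  have h2 := hs.2 v
  have hvt := hv.1
  have hst := hs.1
  have hvb := hbot v
  have hsb := hbot s
  lift F v to ℝ using ⟨hvt, hvb⟩ with a
  lift F s to ℝ using ⟨hst, hsb⟩ with b
  norm_cast at h1 h2
  simp only [map_sub, sub_self, map_zero, zero_apply, inner_sub_left, inner_sub_right,
    sub_apply] at *
  linarith [hskew v s]

omit [CompleteSpace E] [CompleteSpace H] in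
theorem IsFBStep.form_le (hbot : ∀ x, F x ≠ ⊥) (hskew : ∀ a b, S a b = -S b a)
    (hsym : ∀ a b, B a b = B b a) (hμ : 0 < μ)
    (hC : ∀ x y, μ⁻¹ * ‖C x - C y‖ ^ 2 ≤ ⟪C x - C y, x - y⟫)
    (hκ : ∀ a, κ * ‖a‖ ^ 2 ≤ B a a) (hμρ : μ < 2 * ρ) (hρ : ∀ a, ρ * ‖P a‖ ^ 2 ≤ B a a)
    {w v s : E} (hv : IsFBStep F B S c P C w v) (hs : IsFBStep F B S c P C s s) :
    B (v - s) (v - s) + (1 - μ / (2 * ρ)) * κ * ‖w - v‖ ^ 2 ≤ B (w - s) (w - s) := by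
  have h1 := hv.inner_le hbot hskew hs
  have h2 := hC (P w) (P s)
  set d := C (P w) - C (P s)
  have h3 : ⟪d, P v - P s⟫ = ⟪d, P w - P s⟫ - ⟪d, P (w - v)⟫ := by
    rw [← inner_sub_right, map_sub]; congr 1; abel
  have h4 := real_inner_le_norm d (P (w - v))
  have h5 : ‖d‖ * ‖P (w - v)‖ ≤ μ⁻¹ * ‖d‖ ^ 2 + μ / 4 * ‖P (w - v)‖ ^ 2 := by
    have h6 : 0 ≤ μ⁻¹ * (‖d‖ - μ / 2 * ‖P (w - v)‖) ^ 2 := by positivity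
    have h7 : μ⁻¹ * (‖d‖ - μ / 2 * ‖P (w - v)‖) ^ 2 =
        μ⁻¹ * ‖d‖ ^ 2 - ‖d‖ * ‖P (w - v)‖ + μ / 4 * ‖P (w - v)‖ ^ 2 := by
      field_simp; ring
    linarith
  have hρ0 : 0 < ρ := by linarith
  have h8 : B (w - s) (w - s) =
      B (v - s) (v - s) + B (w - v) (w - v) + 2 * B (w - v) (v - s) := by
    have : w - s = (w - v) + (v - s) := by abel
    rw [this, map_add, map_add, add_apply, add_apply,
      hsym (v - s) (w - v)]
    ring
  have h9 : μ / 2 * ‖P (w - v)‖ ^ 2 ≤ μ / (2 * ρ) * B (w - v) (w - v) := by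
    have : μ / 2 * ‖P (w - v)‖ ^ 2 = μ / (2 * ρ) * (ρ * ‖P (w - v)‖ ^ 2) := by field_simp
    rw [this]
    exact mul_le_mul_of_nonneg_left (hρ _) (by positivity)
  have h10 : 0 ≤ 1 - μ / (2 * ρ) := by
    rw [sub_nonneg, div_le_one (by linarith)]; exact hμρ.le
  have h11 := mul_le_mul_of_nonneg_left (hκ (w - v)) h10
  linarith

/-- Weak limits of approximate fixed points of the forward–backward map are fixed points. -/
theorem IsFBStep.of_weakTendsto (hbot : ∀ x, F x ≠ ⊥) (hF : WeakLsc F)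
    (hskew : ∀ a b, S a b = -S b a) (hμ : 0 < μ)
    (hC : ∀ x y, μ⁻¹ * ‖C x - C y‖ ^ 2 ≤ ⟪C x - C y, x - y⟫)
    {U : Ultrafilter ℕ} {w v : ℕ → E} {s w' : E} {R : ℝ} (hR : ∀ n, ‖v n‖ ≤ R)
    (hC_tendsto : Tendsto (fun n => C (P (w n))) U (𝓝 (C (P s))))
    (hstep : ∀ n, IsFBStep F B S c P C (w n) (v n))
    (hs : IsFBStep F B S c P C s s)
    (hwv : Tendsto (fun n => w n - v n) U (𝓝 0)) (hw : WeakTendsto w U w') :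
    IsFBStep F B S c P C w' w' := by
  have hv : WeakTendsto v U w' := hw.of_sub hwv
  have hCw' : C (P s) = C (P w') := by
    have h1 : Tendsto (fun n => ⟪C (P (w n)) - C (P w'), P (w n) - P w'⟫) U (𝓝 0) := by
      have hb : ∃ R', ∀ᶠ n in (U : Filter ℕ), ‖P (w n) - P w'‖ ≤ R' := by
        refine ⟨‖P‖ * (1 + R) + ‖P w'‖, ?_⟩
        filter_upwards [hwv.norm.eventually (gt_mem_nhds (by simp : ‖(0 : E)‖ < 1))] with n hn
        refine (norm_sub_le _ _).trans (add_le_add_left ((P.le_opNorm _).trans ?_) _)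
        gcongr
        calc ‖w n‖ = ‖(w n - v n) + v n‖ := by rw [sub_add_cancel]
          _ ≤ 1 + R := (norm_add_le _ _).trans (add_le_add hn.le (hR n))
      obtain ⟨R', hR'⟩ := hb
      have h2 : Tendsto (fun n => ⟪C (P (w n)) - C (P s), P (w n) - P w'⟫) U (𝓝 0) := by
        have h3 : Tendsto (fun n => ‖C (P (w n)) - C (P s)‖ * R') U (𝓝 0) := by
          simpa using (hC_tendsto.sub_const (C (P s))).norm.mul_const R'
        refine squeeze_zero_norm' ?_ h3
        filter_upwards [hR'] with n hn
        exact (norm_inner_le_norm _ _).trans (mul_le_mul_of_nonneg_left hn (norm_nonneg _))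
      have h4 : Tendsto (fun n => ⟪C (P s) - C (P w'), P (w n) - P w'⟫) U (𝓝 0) := by
        have h5 := ((hw.map P) (C (P s) - C (P w'))).sub_const ⟪P w', C (P s) - C (P w')⟫
        simpa only [sub_self, ← inner_sub_left, real_inner_comm] using h5
      refine (by simpa using h2.add h4 : Tendsto _ _ _).congr fun n => ?_
      rw [← inner_add_left, sub_add_sub_cancel]
    have h6 := ((hC_tendsto.sub_const (C (P w'))).norm.pow 2).const_mul μ⁻¹
    have h7 := le_of_tendsto_of_tendsto' h6 h1 fun n => hC _ _
    have h8 : ‖C (P s) - C (P w')‖ ^ 2 ≤ 0 := by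
      by_contra! h
      have := mul_pos (inv_pos.2 hμ) h
      linarith
    have h9 : ‖C (P s) - C (P w')‖ = 0 := by
      have := sq_nonneg ‖C (P s) - C (P w')‖
      exact pow_eq_zero_iff two_ne_zero |>.1 (le_antisymm h8 this)
    exact sub_eq_zero.1 (norm_eq_zero.1 h9)
  have main : ∀ (u : E) (t : ℝ), F u = t → F w' ≤
      ((t - (-⟪C (P w'), P (u - w')⟫ - S w' u - c (u - w')) : ℝ) : EReal) := by
    intro u t hu
    have hreal : Tendsto (fun n => t - (B (w n - v n) (u - v n) - ⟪C (P (w n)), P (u - v n)⟫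
        - S (v n) u - c (u - v n))) U
        (𝓝 (t - (0 - ⟪C (P w'), P (u - w')⟫ - S w' u - c (u - w')))) := by
      refine tendsto_const_nhds.sub (((Tendsto.sub ?_ ?_).sub ?_).sub ?_)
      · exact tendsto_clm_apply₂_zero B hwv (R := ‖u‖ + R) fun n =>
          (norm_sub_le _ _).trans (add_le_add_right (hR n) _)
      · have h1 : Tendsto (fun n => ⟪C (P (w n)) - C (P w'), P (u - v n)⟫) U (𝓝 0) := by
          have h3 : Tendsto (fun n => ‖C (P (w n)) - C (P w')‖ * (‖P‖ * (‖u‖ + R))) U (𝓝 0) := by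
            rw [← hCw']
            simpa using (hC_tendsto.sub_const (C (P s))).norm.mul_const (‖P‖ * (‖u‖ + R))
          refine squeeze_zero_norm (fun n => (norm_inner_le_norm _ _).trans ?_) h3
          refine mul_le_mul_of_nonneg_left ((P.le_opNorm _).trans ?_) (norm_nonneg _)
          exact mul_le_mul_of_nonneg_left ((norm_sub_le _ _).trans (add_le_add_right (hR n) _))
            (norm_nonneg _)
        have h2 : Tendsto (fun n => ⟪C (P w'), P (u - v n)⟫) U (𝓝 ⟪C (P w'), P (u - w')⟫) := by
          have h3 := ((hv.map P) (C (P w'))).const_sub ⟪P u, C (P w')⟫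
          simp only [real_inner_comm (C (P w'))] at h3
          simpa only [map_sub, inner_sub_right] using h3
        refine (by simpa only [zero_add] using h1.add h2 : Tendsto _ _ _).congr fun n => ?_
        rw [← inner_add_left, sub_add_cancel]
      · simp only [fun n => hskew (v n) u, hskew w' u]
        exact (hv.apply (S u)).neg
      · simp only [map_sub]
        exact (hv.apply c).const_sub (c u)
    obtain ⟨a, -, ha⟩ := isCompact_univ.ultrafilter_le_nhds (U.map fun n => F (v n)) (by simp)
    refine (hF U v w' hv a ha).trans ?_
    rw [← zero_sub]
    refine le_of_tendsto_of_tendsto' ha ((continuous_coe_real_ereal.tendsto _).comp hreal)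
      fun n => ?_
    have h1 := (hstep n).2 u
    have h2 := (hstep n).1
    have h3 := hbot (v n)
    rw [hu] at h1
    dsimp only [Function.comp_apply]
    lift F (v n) to ℝ using ⟨h2, h3⟩ with b
    norm_cast at *
    linarith
  have hst := hs.1
  have hsb := hbot s
  have hw't : F w' ≠ ⊤ := by
    have h1 := main s
    lift F s to ℝ using ⟨hst, hsb⟩ with b
    exact ((h1 b rfl).trans_lt (EReal.coe_lt_top _)).ne
  refine ⟨hw't, fun u => ?_⟩
  have h1 := main u
  have hub := hbot u
  have hwb := hbot w'
  induction hu : F u using EReal.rec with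
  | bot => exact absurd hu hub
  | top => simp
  | coe r =>
    have h2 := h1 r hu
    lift F w' to ℝ using ⟨hw't, hwb⟩ with b
    rw [sub_self, map_zero, zero_apply, zero_sub]
    norm_cast at *
    linarith

/-- Weak convergence of the relaxed, variable-metric forward–backward iteration with summable
errors. -/
theorem exists_weakTendsto_of_forwardBackward (hbot : ∀ x, F x ≠ ⊥) (hF : WeakLsc F)
    (hskew : ∀ a b, S a b = -S b a)
    (hsym : ∀ a b, B a b = B b a) (hμ : 0 < μ)
    (hC : ∀ x y, μ⁻¹ * ‖C x - C y‖ ^ 2 ≤ ⟪C x - C y, x - y⟫)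
    (hκ0 : 0 < κ) (hκ : ∀ a, κ * ‖a‖ ^ 2 ≤ B a a) (hμρ : μ < 2 * ρ)
    (hρ : ∀ a, ρ * ‖P a‖ ^ 2 ≤ B a a)
    (hsol : ∃ s, IsFBStep F B S c P C s s) {w wt v : ℕ → E}
    (hstep : ∀ n, IsFBStep F B S c P C (w n) (v n))
    (herr : Summable fun n => ‖wt n - v n‖) {ε : ℝ} (hε : 0 < ε) {lam : ℕ → ℝ}
    (hlam : ∀ n, lam n ∈ Set.Icc ε 1) (hw : ∀ n, w (n + 1) = w n + lam n • (wt n - w n)) :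
    ∃ s, IsFBStep F B S c P C s s ∧ WeakTendsto w atTop s := by
  have hpos : ∀ a, 0 ≤ B a a := fun a => le_trans (by positivity) (hκ a)
  have hρ0 : 0 < ρ := by linarith
  set δ := (1 - μ / (2 * ρ)) * κ with hδ
  have hδ0 : 0 < δ := mul_pos (by rw [sub_pos, div_lt_one (by linarith)]; exact hμρ) hκ0
  have hrelax : ∀ s, IsFBStep F B S c P C s s → ∀ n,
      B (w n + lam n • (v n - w n) - s) (w n + lam n • (v n - w n) - s) +
        ε * δ * ‖w n - v n‖ ^ 2 ≤ B (w n - s) (w n - s) := by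
    intro s hs n
    have h1 := (hstep n).form_le hbot hskew hsym hμ hC hκ hμρ hρ hs
    have h2 : w n + lam n • (v n - w n) - s = (1 - lam n) • (w n - s) + lam n • (v n - s) := by
      module
    have h3 : w n - v n = (w n - s) - (v n - s) := by abel
    have h4 := hpos ((w n - s) - (v n - s))
    rw [h2]
    obtain ⟨hl1, hl2⟩ := hlam n
    rw [← hδ] at h1
    have h5 : ε * (δ * ‖w n - v n‖ ^ 2) ≤ lam n * (δ * ‖w n - v n‖ ^ 2) :=
      mul_le_mul_of_nonneg_right hl1 (by positivity)
    have h6 : 0 ≤ lam n * (1 - lam n) * B (w n - s - (v n - s)) (w n - s - (v n - s)) :=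
      mul_nonneg (mul_nonneg (by linarith) (by linarith)) h4
    have h7 := mul_le_mul_of_nonneg_left h1 (by linarith : (0 : ℝ) ≤ lam n)
    rw [map_sub B (w n - s) (v n - s)] at h6
    simp only [sub_apply, map_sub _ (w n - s) (v n - s)] at h6
    simp only [map_add, map_smul, add_apply, smul_apply,
      smul_eq_mul]
    rw [hsym (v n - s) (w n - s)] at h6 ⊢
    linarith
  set η : ℕ → ℝ := fun n => √‖B‖ * ‖wt n - v n‖ with hη
  have hη0 : ∀ n, 0 ≤ η n := fun n => by positivity
  have hηs : Summable η := herr.mul_left _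
  have hwn : ∀ n, w (n + 1) = (w n + lam n • (v n - w n)) + lam n • (wt n - v n) := by
    intro n; rw [hw]; module
  have hNle : ∀ s n, √(B (w (n + 1) - s) (w (n + 1) - s)) ≤
      √(B (w n + lam n • (v n - w n) - s) (w n + lam n • (v n - w n) - s)) + η n := by
    intro s n
    have h1 : w (n + 1) - s = (w n + lam n • (v n - w n) - s) + lam n • (wt n - v n) := by
      rw [hwn]; abel
    rw [h1]
    refine (sqrt_form_add_le B hsym hpos _ _).trans (add_le_add_right ?_ _)
    obtain ⟨hl1, hl2⟩ := hlam n
    refine Real.sqrt_le_iff.2 ⟨hη0 n, ?_⟩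
    refine ((Real.le_norm_self _).trans (B.le_opNorm₂ _ _)).trans ?_
    rw [hη, mul_pow, Real.sq_sqrt (norm_nonneg B), norm_smul, Real.norm_eq_abs,
      abs_of_nonneg (by linarith)]
    have h2 : lam n * ‖wt n - v n‖ ≤ ‖wt n - v n‖ :=
      mul_le_of_le_one_left (norm_nonneg _) hl2
    rw [mul_assoc, sq]
    have h3 : 0 ≤ lam n * ‖wt n - v n‖ := mul_nonneg (by linarith) (norm_nonneg _)
    gcongr
  have hconv : ∀ s, IsFBStep F B S c P C s s →
      ∃ b, Tendsto (fun n => √(B (w n - s) (w n - s))) atTop (𝓝 b) := by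
    intro s hs
    refine tendsto_of_le_add_summable (fun n => Real.sqrt_nonneg _) hη0 hηs fun n => ?_
    refine (hNle s n).trans (add_le_add_left (Real.sqrt_le_sqrt ?_) _)
    have := hrelax s hs n
    have h2 : 0 ≤ ε * δ * ‖w n - v n‖ ^ 2 := by positivity
    linarith
  obtain ⟨s, hs⟩ := hsol
  have hwv : Tendsto (fun n => w n - v n) atTop (𝓝 0) := by
    obtain ⟨b, hb⟩ := hconv s hs
    have hη_tendsto := hηs.tendsto_atTop_zero
    have h1 : Tendsto (fun n => (ε * δ)⁻¹ * (√(B (w n - s) (w n - s)) ^ 2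
        - √(B (w (n + 1) - s) (w (n + 1) - s)) ^ 2
        + 2 * √(B (w (n + 1) - s) (w (n + 1) - s)) * η n)) atTop (𝓝 0) := by
      have hb' := hb.comp (tendsto_add_atTop_nat 1)
      have := (((hb.pow 2).sub (hb'.pow 2)).add ((hb'.const_mul 2).mul hη_tendsto)).const_mul
        (ε * δ)⁻¹
      simpa using this
    have h2 : Tendsto (fun n => ‖w n - v n‖ ^ 2) atTop (𝓝 0) := by
      refine squeeze_zero (fun n => by positivity) (fun n => ?_) h1
      have h3 := hrelax s hs n
      have h4 := hNle s n
      rw [← Real.sq_sqrt (hpos (w n - s)), ← Real.sq_sqrt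
        (hpos (w n + lam n • (v n - w n) - s))] at h3
      set A := √(B (w (n + 1) - s) (w (n + 1) - s))
      set D := √(B (w n + lam n • (v n - w n) - s) (w n + lam n • (v n - w n) - s))
      have hA : 0 ≤ A := Real.sqrt_nonneg _
      have hD : 0 ≤ D := Real.sqrt_nonneg _
      have h5 : A ^ 2 - 2 * A * η n ≤ D ^ 2 := by
        rcases le_total (η n) A with h | h
        · have : (A - η n) ^ 2 ≤ D ^ 2 := pow_le_pow_left₀ (by linarith) (by linarith) 2
          nlinarith [hη0 n]
        · nlinarith [hη0 n]
      rw [le_inv_mul_iff₀ (by positivity)]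
      linarith
    have h3 : Tendsto (fun n => ‖w n - v n‖) atTop (𝓝 0) := by
      have := h2.sqrt
      simpa [Real.sqrt_sq] using this
    exact tendsto_zero_iff_norm_tendsto_zero.2 h3
  have hbddw : ∃ R, ∀ n, ‖w n - s‖ ≤ R := by
    obtain ⟨b, hb⟩ := hconv s hs
    obtain ⟨R, hR⟩ := hb.bddAbove_range
    refine ⟨√(κ⁻¹ * R ^ 2), fun n => Real.le_sqrt_of_sq_le ?_⟩
    have h1 := hR ⟨n, rfl⟩
    dsimp only at h1
    rw [le_inv_mul_iff₀ hκ0]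
    refine (hκ _).trans ?_
    rw [← Real.sq_sqrt (hpos (w n - s))]
    exact pow_le_pow_left₀ (Real.sqrt_nonneg _) h1 2
  obtain ⟨R, hR⟩ := hbddw
  obtain ⟨R₁, hR₁⟩ := hwv.norm.bddAbove_range
  have hvs : ∀ n, ‖v n - s‖ ≤ R + R₁ := by
    intro n
    have h1 : v n - s = (w n - s) - (w n - v n) := by abel
    rw [h1]
    exact (norm_sub_le _ _).trans (add_le_add (hR n) (hR₁ ⟨n, rfl⟩))
  have hC_tendsto : Tendsto (fun n => C (P (w n))) atTop (𝓝 (C (P s))) := by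
    have hCb : ∀ n, ‖C (P (w n)) - C (P s)‖ ≤ μ * (‖P‖ * R) := by
      intro n
      have h1 := hC (P (w n)) (P s)
      have h2 := real_inner_le_norm (C (P (w n)) - C (P s)) (P (w n) - P s)
      have h3 : ‖P (w n) - P s‖ ≤ ‖P‖ * R := by
        rw [← map_sub]
        exact (P.le_opNorm _).trans (mul_le_mul_of_nonneg_left (hR n) (norm_nonneg _))
      set D := ‖C (P (w n)) - C (P s)‖
      have hD : 0 ≤ D := norm_nonneg _
      rcases hD.eq_or_lt with h | h
      · rw [← h]
        exact mul_nonneg hμ.le ((norm_nonneg _).trans h3)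
      · have h4 : D * (μ⁻¹ * D) ≤ D * (‖P‖ * R) := by
          have := mul_le_mul_of_nonneg_left h3 hD
          nlinarith
        have h5 := le_of_mul_le_mul_left h4 h
        rwa [inv_mul_le_iff₀ hμ] at h5
    have h1 : Tendsto (fun n => μ * (B (w n - v n) (v n - s) +
        μ * (‖P‖ * R) * (‖P‖ * ‖w n - v n‖))) atTop (𝓝 0) := by
      have h2 := ((hwv.norm.const_mul ‖P‖).const_mul (μ * (‖P‖ * R)))
      have h3 := ((tendsto_clm_apply₂_zero B hwv hvs).add h2).const_mul μ
      simpa using h3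
    have h2 : Tendsto (fun n => ‖C (P (w n)) - C (P s)‖ ^ 2) atTop (𝓝 0) := by
      refine squeeze_zero (fun n => by positivity) (fun n => ?_) h1
      have h3 := (hstep n).inner_le hbot hskew hs
      have h4 := hC (P (w n)) (P s)
      set d := C (P (w n)) - C (P s)
      have h5 : ⟪d, P (v n) - P s⟫ = ⟪d, P (w n) - P s⟫ - ⟪d, P (w n - v n)⟫ := by
        rw [← inner_sub_right, map_sub]; congr 1; abel
      have h6 : ⟪d, P (w n - v n)⟫ ≤ μ * (‖P‖ * R) * (‖P‖ * ‖w n - v n‖) :=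
        (real_inner_le_norm _ _).trans (mul_le_mul (hCb n) (P.le_opNorm _) (norm_nonneg _)
          ((norm_nonneg _).trans (hCb n)))
      rw [← inv_mul_le_iff₀ hμ]
      linarith
    have h3 : Tendsto (fun n => ‖C (P (w n)) - C (P s)‖) atTop (𝓝 0) := by
      have := h2.sqrt
      simpa [Real.sqrt_sq] using this
    exact tendsto_sub_nhds_zero_iff.1 (tendsto_zero_iff_norm_tendsto_zero.2 h3)
  have hw_bdd : ∀ n, ‖w n‖ ≤ R + ‖s‖ := fun n => by
    rw [← sub_add_cancel (w n) s]
    exact (norm_add_le _ _).trans (add_le_add_left (hR n) _)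
  have hv_bdd : ∀ n, ‖v n‖ ≤ R + R₁ + ‖s‖ := fun n => by
    rw [← sub_add_cancel (v n) s]
    exact (norm_add_le _ _).trans (add_le_add_left (hvs n) _)
  have hcluster : ∀ (U : Ultrafilter ℕ), (U : Filter ℕ) ≤ atTop → ∀ s', WeakTendsto w U s' →
      IsFBStep F B S c P C s' s' := fun U hU s' h =>
    IsFBStep.of_weakTendsto hbot hF hskew hμ hC hv_bdd (hC_tendsto.mono_left hU) hstep hs
      (hwv.mono_left hU) h
  have hunique : ∀ (U U' : Ultrafilter ℕ), (U : Filter ℕ) ≤ atTop → (U' : Filter ℕ) ≤ atTop →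
      ∀ a b, WeakTendsto w U a → WeakTendsto w U' b → a = b := by
    intro U U' hU hU' a b ha hb
    obtain ⟨ra, hra⟩ := hconv a (hcluster U hU a ha)
    obtain ⟨rb, hrb⟩ := hconv b (hcluster U' hU' b hb)
    have h1 : Tendsto (fun n => B (a - b) (w n)) atTop
        (𝓝 ((rb ^ 2 - ra ^ 2 + B a a - B b b) / 2)) := by
      refine ((((hrb.pow 2).sub (hra.pow 2)).add_const (B a a)).sub_const (B b b)).div_const 2
        |>.congr fun n => ?_
      rw [Real.sq_sqrt (hpos _), Real.sq_sqrt (hpos _)]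
      simp only [map_sub, sub_apply, hsym (w n) a, hsym (w n) b]
      ring
    have h2 := tendsto_nhds_unique (h1.mono_left hU) (ha.apply (B (a - b)))
    have h3 := tendsto_nhds_unique (h1.mono_left hU') (hb.apply (B (a - b)))
    have h4 : B (a - b) (a - b) = 0 := by rw [map_sub (B (a - b)), ← h2, ← h3, sub_self]
    have h5 := hκ (a - b)
    rw [h4] at h5
    have h6 : ‖a - b‖ ^ 2 ≤ 0 := by
      by_contra! h
      have := mul_pos hκ0 h
      linarith
    have h7 : ‖a - b‖ = 0 := pow_eq_zero_iff two_ne_zero |>.1 (le_antisymm h6 (sq_nonneg _))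
    exact sub_eq_zero.1 (norm_eq_zero.1 h7)
  let U₀ : Ultrafilter ℕ := Ultrafilter.of atTop
  obtain ⟨s₀, hs₀⟩ := exists_weakTendsto_of_bounded U₀ hw_bdd
  refine ⟨s₀, hcluster U₀ (Ultrafilter.of_le _) s₀ hs₀, fun d => ?_⟩
  rw [tendsto_iff_ultrafilter]
  intro U hU
  obtain ⟨s', hs'⟩ := exists_weakTendsto_of_bounded U hw_bdd
  rw [hunique U₀ U (Ultrafilter.of_le _) hU s₀ s' hs₀ hs']
  exact hs' d

end ForwardBackward

/-- The block of dual variables attached to one composite term. -/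
abbrev DualBlock (X Y G : Type*) : Type _ :=
  WithLp 2 (WithLp 2 (X × Y) × WithLp 2 (G × WithLp 2 (G × G)))

/-- The Hilbert direct sum of all primal and dual variables. -/
def PrimalDual {ι : Type*} (H : Type*) (X Y G : ι → Type*) : Type _ :=
  WithLp 2 (H × PiLp 2 fun i => DualBlock (X i) (Y i) (G i))

namespace PrimalDual

section Projections

variable {ι : Type*} [Fintype ι] {H : Type*} [NormedAddCommGroup H] [InnerProductSpace ℝ H]
  {G : ι → Type*} [∀ i, NormedAddCommGroup (G i)] [∀ i, InnerProductSpace ℝ (G i)]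
  {X : ι → Type*} [∀ i, NormedAddCommGroup (X i)] [∀ i, InnerProductSpace ℝ (X i)]
  {Y : ι → Type*} [∀ i, NormedAddCommGroup (Y i)] [∀ i, InnerProductSpace ℝ (Y i)]

instance : NormedAddCommGroup (PrimalDual H X Y G) :=
  inferInstanceAs (NormedAddCommGroup (WithLp 2 (H × PiLp 2 fun i =>
    DualBlock (X i) (Y i) (G i))))

instance : InnerProductSpace ℝ (PrimalDual H X Y G) :=
  inferInstanceAs (InnerProductSpace ℝ (WithLp 2 (H × PiLp 2 fun i =>
    DualBlock (X i) (Y i) (G i))))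

instance [CompleteSpace H] [∀ i, CompleteSpace (X i)] [∀ i, CompleteSpace (Y i)]
    [∀ i, CompleteSpace (G i)] : CompleteSpace (PrimalDual H X Y G) :=
  inferInstanceAs (CompleteSpace (WithLp 2 (H × PiLp 2 fun i =>
    DualBlock (X i) (Y i) (G i))))

/-- The projection onto the primal variable. -/
def xProj : PrimalDual H X Y G →L[ℝ] H :=
  WithLp.fstL 2 ℝ H (PiLp 2 fun i => DualBlock (X i) (Y i) (G i))

/-- The projection onto the `i`-th block of dual variables. -/
def block (i : ι) : PrimalDual H X Y G →L[ℝ]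
    DualBlock (X i) (Y i) (G i) :=
  (PiLp.proj 2 _ i).comp
    (WithLp.sndL 2 ℝ H (PiLp 2 fun i => DualBlock (X i) (Y i) (G i)))

/-- The projection onto the variable `pᵢ`. -/
def pProj (i : ι) : PrimalDual H X Y G →L[ℝ] X i :=
  (WithLp.fstL 2 ℝ _ _).comp ((WithLp.fstL 2 ℝ _ _).comp (block i))

/-- The projection onto the variable `qᵢ`. -/
def qProj (i : ι) : PrimalDual H X Y G →L[ℝ] Y i :=
  (WithLp.sndL 2 ℝ _ _).comp ((WithLp.fstL 2 ℝ _ _).comp (block i))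

/-- The projection onto the variable `zᵢ`. -/
def zProj (i : ι) : PrimalDual H X Y G →L[ℝ] G i :=
  (WithLp.fstL 2 ℝ _ _).comp ((WithLp.sndL 2 ℝ _ _).comp (block i))

/-- The projection onto the variable `yᵢ`. -/
def yProj (i : ι) : PrimalDual H X Y G →L[ℝ] G i :=
  (WithLp.fstL 2 ℝ _ _).comp
    ((WithLp.sndL 2 ℝ _ _).comp ((WithLp.sndL 2 ℝ _ _).comp (block i)))

/-- The projection onto the variable `vᵢ`. -/
def vProj (i : ι) : PrimalDual H X Y G →L[ℝ] G i :=
  (WithLp.sndL 2 ℝ _ _).comp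
    ((WithLp.sndL 2 ℝ _ _).comp ((WithLp.sndL 2 ℝ _ _).comp (block i)))

/-- The point of the product space with prescribed components. -/
def mk (x : H) (p : ∀ i, X i) (q : ∀ i, Y i) (z y v : ∀ i, G i) : PrimalDual H X Y G :=
  WithLp.toLp 2 (x, WithLp.toLp 2 fun i => WithLp.toLp 2
    (WithLp.toLp 2 (p i, q i), WithLp.toLp 2 (z i, WithLp.toLp 2 (y i, v i))))

variable (x : H) (p : ∀ i, X i) (q : ∀ i, Y i) (z y v : ∀ i, G i) (i : ι)

@[simp] theorem xProj_mk : xProj (mk x p q z y v) = x := rfl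
@[simp] theorem pProj_mk : pProj i (mk x p q z y v) = p i := rfl
@[simp] theorem qProj_mk : qProj i (mk x p q z y v) = q i := rfl
@[simp] theorem zProj_mk : zProj i (mk x p q z y v) = z i := rfl
@[simp] theorem yProj_mk : yProj i (mk x p q z y v) = y i := rfl
@[simp] theorem vProj_mk : vProj i (mk x p q z y v) = v i := rfl

theorem norm_sq_eq (w : PrimalDual H X Y G) :
    ‖w‖ ^ 2 = ‖xProj w‖ ^ 2 + ∑ i, (‖pProj i w‖ ^ 2 + ‖qProj i w‖ ^ 2 + ‖zProj i w‖ ^ 2 +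
      ‖yProj i w‖ ^ 2 + ‖vProj i w‖ ^ 2) := by
  refine (WithLp.prod_norm_sq_eq_of_L2 _).trans ?_
  rw [PiLp.norm_sq_eq_of_L2]
  congr 1
  refine Finset.sum_congr rfl fun i _ => ?_
  simp only [WithLp.prod_norm_sq_eq_of_L2]
  rw [← add_assoc, ← add_assoc]
  rfl

theorem ext_proj {w w' : PrimalDual H X Y G} (hx : xProj w = xProj w')
    (h : ∀ i, pProj i w = pProj i w' ∧ qProj i w = qProj i w' ∧ zProj i w = zProj i w' ∧
      yProj i w = yProj i w' ∧ vProj i w = vProj i w') : w = w' := by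
  rw [← sub_eq_zero, ← norm_eq_zero, ← sq_eq_zero_iff, norm_sq_eq]
  simp [hx, h]

theorem norm_le (w : PrimalDual H X Y G) :
    ‖w‖ ≤ ‖xProj w‖ + ∑ i, (‖pProj i w‖ + ‖qProj i w‖ + ‖zProj i w‖ +
      ‖yProj i w‖ + ‖vProj i w‖) := by
  have hs : ∀ a b : ℝ, 0 ≤ a → 0 ≤ b → a ^ 2 + b ^ 2 ≤ (a + b) ^ 2 := fun a b ha hb => by
    nlinarith [mul_nonneg ha hb]
  refine abs_le_of_sq_le_sq' ?_ (by positivity) |>.2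
  rw [norm_sq_eq]
  refine le_trans ?_ (hs _ _ (by positivity) (by positivity))
  gcongr
  refine le_trans ?_ (Finset.sum_sq_le_sq_sum_of_nonneg fun i _ => by positivity)
  gcongr with i
  refine le_trans ?_ (hs _ _ (by positivity) (by positivity))
  gcongr
  refine le_trans ?_ (hs _ _ (by positivity) (by positivity))
  gcongr
  refine le_trans ?_ (hs _ _ (by positivity) (by positivity))
  gcongr
  exact hs _ _ (by positivity) (by positivity)

end Projections

section Forms

variable {ι : Type*} [Fintype ι]
  {H : Type*} [NormedAddCommGroup H] [InnerProductSpace ℝ H]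
  {G : ι → Type*} [∀ i, NormedAddCommGroup (G i)] [∀ i, InnerProductSpace ℝ (G i)]
  {X : ι → Type*} [∀ i, NormedAddCommGroup (X i)] [∀ i, InnerProductSpace ℝ (X i)]
  {Y : ι → Type*} [∀ i, NormedAddCommGroup (Y i)] [∀ i, InnerProductSpace ℝ (Y i)]

/-- The bilinear form `(a, b) ↦ ⟪P a, Q b⟫`. -/
def innerForm {E F : Type*} [NormedAddCommGroup E] [InnerProductSpace ℝ E]
    [NormedAddCommGroup F] [InnerProductSpace ℝ F] (P Q : E →L[ℝ] F) :
    E →L[ℝ] StrongDual ℝ E :=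
  (innerSL ℝ).bilinearComp P Q

theorem innerForm_apply {E F : Type*} [NormedAddCommGroup E] [InnerProductSpace ℝ E]
    [NormedAddCommGroup F] [InnerProductSpace ℝ F] (P Q : E →L[ℝ] F) (a b : E) :
    innerForm P Q a b = ⟪P a, Q b⟫ := rfl

/-- The bilinear form defining the metric of the primal-dual algorithm. -/
def metric (L : ∀ i, H →L[ℝ] G i) (K : ∀ i, G i →L[ℝ] X i) (M : ∀ i, G i →L[ℝ] Y i)
    (τ : ℝ) (θ₁ θ₂ γ₁ γ₂ σ : ι → ℝ) :
    PrimalDual H X Y G →L[ℝ] StrongDual ℝ (PrimalDual H X Y G) :=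
  τ⁻¹ • innerForm xProj xProj + ∑ i,
    ((θ₁ i)⁻¹ • innerForm (pProj i) (pProj i) + (θ₂ i)⁻¹ • innerForm (qProj i) (qProj i) +
      (γ₁ i)⁻¹ • innerForm (zProj i) (zProj i) + (γ₂ i)⁻¹ • innerForm (yProj i) (yProj i) +
      (σ i)⁻¹ • innerForm (vProj i) (vProj i) -
      innerForm (vProj i) ((L i).comp (xProj : PrimalDual H X Y G →L[ℝ] _)) - innerForm ((L i).comp (xProj : PrimalDual H X Y G →L[ℝ] _)) (vProj i) +
      innerForm ((K i).comp (zProj i : PrimalDual H X Y G →L[ℝ] _)) (pProj i) + innerForm (pProj i) ((K i).comp (zProj i : PrimalDual H X Y G →L[ℝ] _)) +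
      innerForm ((M i).comp (yProj i : PrimalDual H X Y G →L[ℝ] _)) (qProj i) + innerForm (qProj i) ((M i).comp (yProj i : PrimalDual H X Y G →L[ℝ] _)))

theorem metric_apply (L : ∀ i, H →L[ℝ] G i) (K : ∀ i, G i →L[ℝ] X i) (M : ∀ i, G i →L[ℝ] Y i)
    (τ : ℝ) (θ₁ θ₂ γ₁ γ₂ σ : ι → ℝ) (a b : PrimalDual H X Y G) :
    metric L K M τ θ₁ θ₂ γ₁ γ₂ σ a b = τ⁻¹ * ⟪xProj a, xProj b⟫ + ∑ i,
      ((θ₁ i)⁻¹ * ⟪pProj i a, pProj i b⟫ + (θ₂ i)⁻¹ * ⟪qProj i a, qProj i b⟫ +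
        (γ₁ i)⁻¹ * ⟪zProj i a, zProj i b⟫ + (γ₂ i)⁻¹ * ⟪yProj i a, yProj i b⟫ +
        (σ i)⁻¹ * ⟪vProj i a, vProj i b⟫ -
        ⟪vProj i a, L i (xProj b)⟫ - ⟪L i (xProj a), vProj i b⟫ +
        ⟪K i (zProj i a), pProj i b⟫ + ⟪pProj i a, K i (zProj i b)⟫ +
        ⟪M i (yProj i a), qProj i b⟫ + ⟪qProj i a, M i (yProj i b)⟫) := by
  simp only [metric, add_apply, sub_apply, smul_apply, _root_.sum_apply, innerForm_apply,
    ContinuousLinearMap.comp_apply, smul_eq_mul]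

theorem metric_comm (L : ∀ i, H →L[ℝ] G i) (K : ∀ i, G i →L[ℝ] X i) (M : ∀ i, G i →L[ℝ] Y i)
    (τ : ℝ) (θ₁ θ₂ γ₁ γ₂ σ : ι → ℝ) (a b : PrimalDual H X Y G) :
    metric L K M τ θ₁ θ₂ γ₁ γ₂ σ a b = metric L K M τ θ₁ θ₂ γ₁ γ₂ σ b a := by
  rw [metric_apply, metric_apply, real_inner_comm (xProj b)]
  congr 1
  refine Finset.sum_congr rfl fun i _ => ?_
  rw [real_inner_comm (pProj i b) (pProj i a), real_inner_comm (qProj i b) (qProj i a),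
    real_inner_comm (zProj i b) (zProj i a), real_inner_comm (yProj i b) (yProj i a),
    real_inner_comm (vProj i b) (vProj i a), real_inner_comm (L i (xProj b)) (vProj i a),
    real_inner_comm (vProj i b) (L i (xProj a)), real_inner_comm (pProj i b) (K i (zProj i a)),
    real_inner_comm (K i (zProj i b)) (pProj i a), real_inner_comm (qProj i b) (M i (yProj i a)),
    real_inner_comm (M i (yProj i b)) (qProj i a)]
  ring

/-- The skew-symmetric form coupling the primal and dual variables. -/
def skew (L : ∀ i, H →L[ℝ] G i) (K : ∀ i, G i →L[ℝ] X i) (M : ∀ i, G i →L[ℝ] Y i) :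
    PrimalDual H X Y G →L[ℝ] StrongDual ℝ (PrimalDual H X Y G) :=
  ∑ i, ((innerForm (vProj i) ((L i).comp (xProj : PrimalDual H X Y G →L[ℝ] _)) - innerForm ((L i).comp (xProj : PrimalDual H X Y G →L[ℝ] _)) (vProj i)) -
    (innerForm ((K i).comp (zProj i : PrimalDual H X Y G →L[ℝ] _)) (pProj i) - innerForm (pProj i) ((K i).comp (zProj i : PrimalDual H X Y G →L[ℝ] _))) -
    (innerForm ((M i).comp (yProj i : PrimalDual H X Y G →L[ℝ] _)) (qProj i) - innerForm (qProj i) ((M i).comp (yProj i : PrimalDual H X Y G →L[ℝ] _))) -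
    (innerForm (vProj i) (zProj i) - innerForm (zProj i) (vProj i)) -
    (innerForm (vProj i) (yProj i) - innerForm (yProj i) (vProj i)))

theorem skew_apply (L : ∀ i, H →L[ℝ] G i) (K : ∀ i, G i →L[ℝ] X i) (M : ∀ i, G i →L[ℝ] Y i)
    (a b : PrimalDual H X Y G) :
    skew L K M a b = ∑ i, ((⟪vProj i a, L i (xProj b)⟫ - ⟪L i (xProj a), vProj i b⟫) -
      (⟪K i (zProj i a), pProj i b⟫ - ⟪pProj i a, K i (zProj i b)⟫) -
      (⟪M i (yProj i a), qProj i b⟫ - ⟪qProj i a, M i (yProj i b)⟫) -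
      (⟪vProj i a, zProj i b⟫ - ⟪zProj i a, vProj i b⟫) -
      (⟪vProj i a, yProj i b⟫ - ⟪yProj i a, vProj i b⟫)) := by
  simp only [skew, sub_apply, _root_.sum_apply, innerForm_apply, ContinuousLinearMap.comp_apply]

theorem skew_comm (L : ∀ i, H →L[ℝ] G i) (K : ∀ i, G i →L[ℝ] X i) (M : ∀ i, G i →L[ℝ] Y i)
    (a b : PrimalDual H X Y G) : skew L K M a b = -skew L K M b a := by
  rw [skew_apply, skew_apply, ← Finset.sum_neg_distrib]
  refine Finset.sum_congr rfl fun i _ => ?_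
  rw [real_inner_comm (L i (xProj b)) (vProj i a),
    real_inner_comm (vProj i b) (L i (xProj a)), real_inner_comm (pProj i b) (K i (zProj i a)),
    real_inner_comm (K i (zProj i b)) (pProj i a), real_inner_comm (qProj i b) (M i (yProj i a)),
    real_inner_comm (M i (yProj i b)) (qProj i a), real_inner_comm (zProj i b) (vProj i a),
    real_inner_comm (vProj i b) (zProj i a), real_inner_comm (yProj i b) (vProj i a),
    real_inner_comm (vProj i b) (yProj i a)]
  ring

/-- The linear part `-⟪z, x⟫ + ∑ ⟪rᵢ, vᵢ⟫` of the primal-dual inclusion. -/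
def linForm (z : H) (r : ∀ i, G i) : StrongDual ℝ (PrimalDual H X Y G) :=
  ∑ i, (innerSL ℝ (r i)).comp (vProj i : PrimalDual H X Y G →L[ℝ] _) -
    (innerSL ℝ z).comp (xProj : PrimalDual H X Y G →L[ℝ] _)

theorem linForm_apply (z : H) (r : ∀ i, G i) (a : PrimalDual H X Y G) :
    linForm z r a = ∑ i, ⟪r i, vProj i a⟫ - ⟪z, xProj a⟫ := by
  simp only [linForm, sub_apply, _root_.sum_apply, ContinuousLinearMap.comp_apply,
    innerSL_apply_apply]

/-- The nonsmooth part `f(x) + ∑ (gᵢ*(pᵢ) + lᵢ*(qᵢ))` of the primal-dual inclusion. -/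
def nonsmooth (f : H → EReal) (g : ∀ i, X i → EReal) (l : ∀ i, Y i → EReal)
    (w : PrimalDual H X Y G) : EReal :=
  f (xProj w) + ∑ i, (econj (g i) (pProj i w) + econj (l i) (qProj i w))

theorem nonsmooth_ne_bot {f : H → EReal} {g : ∀ i, X i → EReal}
    {l : ∀ i, Y i → EReal} (hf : ∀ x, f x ≠ ⊥) (hg : ∀ i x, econj (g i) x ≠ ⊥)
    (hl : ∀ i x, econj (l i) x ≠ ⊥) (w : PrimalDual H X Y G) : nonsmooth f g l w ≠ ⊥ := by
  rw [nonsmooth, Ne, EReal.add_eq_bot_iff, not_or]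
  exact ⟨hf _, EReal.sum_ne_bot _ fun i => by
    rw [Ne, EReal.add_eq_bot_iff, not_or]; exact ⟨hg _ _, hl _ _⟩⟩

end Forms

section Optimality

theorem _root_.EReal.coe_real_sum {ι : Type*} (s : Finset ι) (a : ι → ℝ) :
    ((∑ i ∈ s, a i : ℝ) : EReal) = ∑ i ∈ s, (a i : EReal) := by
  classical
  induction s using Finset.induction_on with
  | empty => simp
  | insert i s hi ih => rw [Finset.sum_insert hi, Finset.sum_insert hi, EReal.coe_add, ih]

theorem _root_.EReal.sum_ne_top {ι : Type*} (s : Finset ι) {a : ι → EReal} (h : ∀ i, a i ≠ ⊤) :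
    ∑ i ∈ s, a i ≠ ⊤ := by
  classical
  induction s using Finset.induction_on with
  | empty => simp
  | insert i s hi ih => rw [Finset.sum_insert hi]; exact EReal.add_ne_top (h i) ih

theorem _root_.EReal.ne_top_of_sum_ne_top {ι : Type*} {s : Finset ι} {a : ι → EReal}
    (hbot : ∀ i, a i ≠ ⊥) (h : ∑ i ∈ s, a i ≠ ⊤) {i : ι} (hi : i ∈ s) : a i ≠ ⊤ := by
  classical
  intro hit
  apply h
  rw [← Finset.add_sum_erase s a hi, hit]
  exact EReal.top_add_of_ne_bot (EReal.sum_ne_bot _ hbot)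

theorem _root_.EReal.ne_top_of_add_ne_top {a b : EReal} (ha : a ≠ ⊥) (hb : b ≠ ⊥)
    (h : a + b ≠ ⊤) : a ≠ ⊤ ∧ b ≠ ⊤ :=
  ⟨fun h1 => h (by rw [h1]; exact EReal.top_add_of_ne_bot hb),
    fun h1 => h (by rw [h1]; exact EReal.add_top_of_ne_bot ha)⟩

theorem _root_.EReal.add_le_of_add_add_le {a b c R : EReal} (hc : c ≠ ⊤) (hc' : c ≠ ⊥)
    (h : c + a + R ≤ c + b) : a + R ≤ b := by
  rw [add_assoc] at h
  lift c to ℝ using ⟨hc, hc'⟩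
  exact EReal.addLECancellable_coe c h

/-- If two families agree off `i`, comparing their sums compares the entries at `i`. -/
theorem _root_.EReal.add_le_of_sum_le {ι : Type*} [Fintype ι] {a b : ι → EReal} {c R : EReal}
    (i : ι) (hab : ∀ j, j ≠ i → a j = b j) (ha : ∀ j, a j ≠ ⊤) (ha' : ∀ j, a j ≠ ⊥)
    (hc : c ≠ ⊤) (hc' : c ≠ ⊥) (h : c + ∑ j, a j + R ≤ c + ∑ j, b j) : a i + R ≤ b i := by
  classical
  have h1 := EReal.add_le_of_add_add_le hc hc' h
  rw [← Finset.sum_erase_add _ _ (Finset.mem_univ i),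
    ← Finset.sum_erase_add _ b (Finset.mem_univ i),
    ← Finset.sum_congr rfl fun j hj => hab j (Finset.ne_of_mem_erase hj)] at h1
  exact EReal.add_le_of_add_add_le (EReal.sum_ne_top _ ha) (EReal.sum_ne_bot _ ha') h1

variable {ι : Type*} [Fintype ι]
  {H : Type*} [NormedAddCommGroup H] [InnerProductSpace ℝ H] [CompleteSpace H]
  {G : ι → Type*} [∀ i, NormedAddCommGroup (G i)] [∀ i, InnerProductSpace ℝ (G i)]
  [∀ i, CompleteSpace (G i)]
  {X : ι → Type*} [∀ i, NormedAddCommGroup (X i)] [∀ i, InnerProductSpace ℝ (X i)]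
  [∀ i, CompleteSpace (X i)]
  {Y : ι → Type*} [∀ i, NormedAddCommGroup (Y i)] [∀ i, InnerProductSpace ℝ (Y i)]
  [∀ i, CompleteSpace (Y i)]
  (L : ∀ i, H →L[ℝ] G i) (K : ∀ i, G i →L[ℝ] X i) (M : ∀ i, G i →L[ℝ] Y i)
  (z : H) (r : ∀ i, G i) (τ : ℝ) (θ₁ θ₂ γ₁ γ₂ σ : ι → ℝ)

theorem linearization_eq (b : H) (w s u : PrimalDual H X Y G) :
    metric L K M τ θ₁ θ₂ γ₁ γ₂ σ (w - s) (u - s) - ⟪b, xProj (u - s)⟫ - skew L K M s u -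
        linForm z r (u - s) =
      ⟪τ⁻¹ • (xProj w - xProj s) - ∑ i, (L i).adjoint (vProj i w) - b + z, xProj (u - s)⟫ +
      ∑ i, (⟪(θ₁ i)⁻¹ • (pProj i w - pProj i s) + K i (zProj i w), pProj i (u - s)⟫ +
        ⟪(θ₂ i)⁻¹ • (qProj i w - qProj i s) + M i (yProj i w), qProj i (u - s)⟫ +
        ⟪(γ₁ i)⁻¹ • (zProj i w - zProj i s) + (K i).adjoint (pProj i w - (2 : ℝ) • pProj i s) +
          vProj i s, zProj i (u - s)⟫ +
        ⟪(γ₂ i)⁻¹ • (yProj i w - yProj i s) + (M i).adjoint (qProj i w - (2 : ℝ) • qProj i s) +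
          vProj i s, yProj i (u - s)⟫ +
        ⟪(σ i)⁻¹ • (vProj i w - vProj i s) + (L i ((2 : ℝ) • xProj s - xProj w) - r i -
          zProj i s - yProj i s), vProj i (u - s)⟫) := by
  have hsu : skew L K M s u = skew L K M s (u - s) := by
    rw [map_sub]; linarith [skew_comm L K M s s]
  rw [hsu]
  generalize u - s = d
  rw [metric_apply, skew_apply, linForm_apply]
  simp only [inner_add_left, inner_sub_left, sum_inner, ContinuousLinearMap.adjoint_inner_left,
    real_inner_smul_left, map_sub, Finset.sum_add_distrib, Finset.sum_sub_distrib,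
    mul_sub, two_smul, map_add]
  ring

variable {L K M z r τ θ₁ θ₂ γ₁ γ₂ σ} {f : H → EReal} {g : ∀ i, X i → EReal}
  {l : ∀ i, Y i → EReal} {h' : H → H}

theorem isFBStep_of_mem_esubdiff {w s : PrimalDual H X Y G}
    (hx : τ⁻¹ • (xProj w - xProj s) - ∑ i, (L i).adjoint (vProj i w) - h' (xProj w) + z ∈
      esubdiff f (xProj s))
    (hp : ∀ i, (θ₁ i)⁻¹ • (pProj i w - pProj i s) + K i (zProj i w) ∈
      esubdiff (econj (g i)) (pProj i s))
    (hq : ∀ i, (θ₂ i)⁻¹ • (qProj i w - qProj i s) + M i (yProj i w) ∈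
      esubdiff (econj (l i)) (qProj i s))
    (hz : ∀ i, (γ₁ i)⁻¹ • (zProj i w - zProj i s) +
      (K i).adjoint (pProj i w - (2 : ℝ) • pProj i s) + vProj i s = 0)
    (hy : ∀ i, (γ₂ i)⁻¹ • (yProj i w - yProj i s) +
      (M i).adjoint (qProj i w - (2 : ℝ) • qProj i s) + vProj i s = 0)
    (hv : ∀ i, (σ i)⁻¹ • (vProj i w - vProj i s) + (L i ((2 : ℝ) • xProj s - xProj w) - r i -
      zProj i s - yProj i s) = 0) :
    IsFBStep (nonsmooth f g l) (metric L K M τ θ₁ θ₂ γ₁ γ₂ σ) (skew L K M) (linForm z r)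
      xProj h' w s := by
  refine ⟨EReal.add_ne_top hx.1 (EReal.sum_ne_top _ fun i =>
    EReal.add_ne_top (hp i).1 (hq i).1), fun u => ?_⟩
  rw [linearization_eq]
  simp only [hz, hy, hv, inner_zero_left, add_zero, nonsmooth]
  rw [EReal.coe_add, EReal.coe_real_sum, add_add_add_comm, ← Finset.sum_add_distrib]
  refine add_le_add (by simpa using hx.2.2 (xProj u)) (Finset.sum_le_sum fun i _ => ?_)
  rw [EReal.coe_add, add_add_add_comm]
  exact add_le_add (by simpa using (hp i).2.2 (pProj i u)) (by simpa using (hq i).2.2 (qProj i u))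

theorem optimality_of_isFBStep (hf : ∀ x, f x ≠ ⊥) (hg : ∀ i x, econj (g i) x ≠ ⊥)
    (hl : ∀ i x, econj (l i) x ≠ ⊥) {s : PrimalDual H X Y G}
    (hs : IsFBStep (nonsmooth f g l) (metric L K M τ θ₁ θ₂ γ₁ γ₂ σ) (skew L K M) (linForm z r)
      xProj h' s s) :
    z - ∑ i, (L i).adjoint (vProj i s) - h' (xProj s) ∈ esubdiff f (xProj s) ∧
    ∀ i, K i (zProj i s) ∈ esubdiff (econj (g i)) (pProj i s) ∧
      M i (yProj i s) ∈ esubdiff (econj (l i)) (qProj i s) ∧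
      (K i).adjoint (pProj i s) = vProj i s ∧ (M i).adjoint (qProj i s) = vProj i s ∧
      L i (xProj s) - r i = zProj i s + yProj i s := by
  classical
  obtain ⟨htop, hs⟩ := hs
  have hbotΨ : ∀ i (a : X i) (b : Y i), econj (g i) a + econj (l i) b ≠ ⊥ := fun i a b => by
    rw [Ne, EReal.add_eq_bot_iff, not_or]; exact ⟨hg _ _, hl _ _⟩
  obtain ⟨hft, hsumt⟩ := EReal.ne_top_of_add_ne_top (hf _)
    (EReal.sum_ne_bot _ fun i => hbotΨ i _ _) htop
  have hΨt : ∀ i, econj (g i) (pProj i s) + econj (l i) (qProj i s) ≠ ⊤ := fun i =>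
    EReal.ne_top_of_sum_ne_top (fun i => hbotΨ i _ _) hsumt (Finset.mem_univ i)
  simp only [linearization_eq] at hs
  simp only [sub_self, smul_zero, zero_sub, zero_add, two_smul, add_sub_cancel_right,
    sub_add_cancel_left] at hs
  refine ⟨⟨hft, hf _, fun x' => ?_⟩, fun i => ?_⟩
  · have h1 := hs (mk x' (fun i => pProj i s) (fun i => qProj i s) (fun i => zProj i s)
      (fun i => yProj i s) (fun i => vProj i s))
    simp only [map_sub, xProj_mk, pProj_mk, qProj_mk, zProj_mk, yProj_mk, vProj_mk, sub_self,
      inner_zero_right, Finset.sum_const_zero, add_zero, nonsmooth] at h1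
    rw [add_comm (f _), add_comm (f _)] at h1
    have h2 := EReal.add_le_of_add_add_le hsumt (EReal.sum_ne_bot _ fun i => hbotΨ i _ _) h1
    convert h2 using 4
    abel
  · have key : ∀ (p' : X i) (q' : Y i) (z' y' v' : G i),
        econj (g i) (pProj i s) + econj (l i) (qProj i s) +
        ((⟪K i (zProj i s), p' - pProj i s⟫ + ⟪M i (yProj i s), q' - qProj i s⟫ +
          ⟪-(K i).adjoint (pProj i s) + vProj i s, z' - zProj i s⟫ +
          ⟪-(M i).adjoint (qProj i s) + vProj i s, y' - yProj i s⟫ +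
          ⟪L i (xProj s) - r i - zProj i s - yProj i s, v' - vProj i s⟫ : ℝ) : EReal) ≤
        econj (g i) p' + econj (l i) q' := by
      intro p' q' z' y' v'
      have h1 := hs (mk (xProj s) (Function.update (fun i => pProj i s) i p')
        (Function.update (fun i => qProj i s) i q') (Function.update (fun i => zProj i s) i z')
        (Function.update (fun i => yProj i s) i y') (Function.update (fun i => vProj i s) i v'))
      simp only [map_sub, map_neg, xProj_mk, pProj_mk, qProj_mk, zProj_mk, yProj_mk, vProj_mk,
        sub_self, inner_zero_right, zero_add, nonsmooth] at h1
      have h2 := EReal.add_le_of_sum_le i (fun j hj => by simp [Function.update_of_ne hj]) hΨt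
        (fun j => hbotΨ j _ _) hft (hf _) h1
      rw [Finset.sum_eq_single i (fun j _ hj => by simp [Function.update_of_ne hj]) (by simp)] at h2
      simpa only [Function.update_self] using h2
    obtain ⟨hgt, hlt⟩ := EReal.ne_top_of_add_ne_top (hg _ _) (hl _ _) (hΨt i)
    have hzero : ∀ z' y' v' : G i,
        ⟪-(K i).adjoint (pProj i s) + vProj i s, z' - zProj i s⟫ +
          ⟪-(M i).adjoint (qProj i s) + vProj i s, y' - yProj i s⟫ +
          ⟪L i (xProj s) - r i - zProj i s - yProj i s, v' - vProj i s⟫ ≤ (0 : ℝ) := by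
      intro z' y' v'
      have h1 := key (pProj i s) (qProj i s) z' y' v'
      simp only [sub_self, inner_zero_right, zero_add] at h1
      lift econj (g i) (pProj i s) + econj (l i) (qProj i s) to ℝ using
        ⟨hΨt i, hbotΨ i _ _⟩ with a
      norm_cast at h1
      linarith
    have hvec : ∀ a : G i, ⟪a, a⟫ ≤ (0 : ℝ) → a = 0 := fun a ha =>
      inner_self_eq_zero.1 (le_antisymm ha real_inner_self_nonneg)
    refine ⟨⟨hgt, hg _ _, fun p' => ?_⟩, ⟨hlt, hl _ _, fun q' => ?_⟩, ?_, ?_, ?_⟩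
    · have h1 := key p' (qProj i s) (zProj i s) (yProj i s) (vProj i s)
      simp only [sub_self, inner_zero_right, add_zero] at h1
      rw [add_comm (econj (g i) _), add_comm (econj (g i) _)] at h1
      exact EReal.add_le_of_add_add_le hlt (hl _ _) h1
    · have h1 := key (pProj i s) q' (zProj i s) (yProj i s) (vProj i s)
      simp only [sub_self, inner_zero_right, add_zero, zero_add] at h1
      exact EReal.add_le_of_add_add_le hgt (hg _ _) h1
    · have h1 := hvec _ (by
        simpa using hzero (zProj i s + (-(K i).adjoint (pProj i s) + vProj i s)) (yProj i s) (vProj i s))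
      exact neg_add_eq_zero.1 h1
    · have h1 := hvec _ (by
        simpa using hzero (zProj i s) (yProj i s + (-(M i).adjoint (qProj i s) + vProj i s)) (vProj i s))
      exact neg_add_eq_zero.1 h1
    · have h1 := hvec _ (by
        simpa using hzero (zProj i s) (yProj i s)
          (vProj i s + (L i (xProj s) - r i - zProj i s - yProj i s)))
      rwa [sub_sub, sub_eq_zero] at h1

end Optimality

section Positivity

theorem two_mul_mul_mul_le {θ γ k α a b : ℝ} (hθ : 0 < θ) (hγ : 0 < γ) (hα : 0 ≤ α)
    (ha : 0 ≤ a) (hb : 0 ≤ b) (h : θ * γ * k ^ 2 ≤ α ^ 2) :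
    2 * (k * a * b) ≤ α * (θ⁻¹ * a ^ 2 + γ⁻¹ * b ^ 2) := by
  obtain ⟨s, hs, rfl⟩ : ∃ s, 0 < s ∧ s ^ 2 = θ :=
    ⟨√θ, Real.sqrt_pos.2 hθ, Real.sq_sqrt hθ.le⟩
  obtain ⟨t, ht, rfl⟩ : ∃ t, 0 < t ∧ t ^ 2 = γ :=
    ⟨√γ, Real.sqrt_pos.2 hγ, Real.sq_sqrt hγ.le⟩
  have hst : s * t * k ≤ α := abs_le_of_sq_le_sq' (by nlinarith) hα |>.2
  obtain ⟨A, hA, rfl⟩ : ∃ A, 0 ≤ A ∧ s * A = a := ⟨a / s, by positivity, by field_simp⟩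
  obtain ⟨B, hB, rfl⟩ : ∃ B, 0 ≤ B ∧ t * B = b := ⟨b / t, by positivity, by field_simp⟩
  have h1 : (s ^ 2)⁻¹ * (s * A) ^ 2 + (t ^ 2)⁻¹ * (t * B) ^ 2 = A ^ 2 + B ^ 2 := by
    field_simp
  rw [h1]
  nlinarith [mul_le_mul_of_nonneg_right hst (mul_nonneg hA hB),
    mul_nonneg hα (sq_nonneg (A - B))]

variable {ι : Type*} [Fintype ι]
  {H : Type*} [NormedAddCommGroup H] [InnerProductSpace ℝ H]
  {G : ι → Type*} [∀ i, NormedAddCommGroup (G i)] [∀ i, InnerProductSpace ℝ (G i)]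
  {X : ι → Type*} [∀ i, NormedAddCommGroup (X i)] [∀ i, InnerProductSpace ℝ (X i)]
  {Y : ι → Type*} [∀ i, NormedAddCommGroup (Y i)] [∀ i, InnerProductSpace ℝ (Y i)]
  {L : ∀ i, H →L[ℝ] G i} {K : ∀ i, G i →L[ℝ] X i} {M : ∀ i, G i →L[ℝ] Y i}
  {τ α : ℝ} {θ₁ θ₂ γ₁ γ₂ σ : ι → ℝ}

theorem sum_two_mul_norm_le (hτ : 0 < τ) (hσ : ∀ i, 0 < σ i) (hα : 0 ≤ α)
    (hL : τ * ∑ i, σ i * ‖L i‖ ^ 2 ≤ α ^ 2) (x : H) (v : ∀ i, G i) :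
    2 * ∑ i, ‖L i‖ * ‖x‖ * ‖v i‖ ≤ α * (τ⁻¹ * ‖x‖ ^ 2 + ∑ i, (σ i)⁻¹ * ‖v i‖ ^ 2) := by
  have h1 : ∑ i, ‖L i‖ * ‖v i‖ ≤
      √(∑ i, σ i * ‖L i‖ ^ 2) * √(∑ i, (σ i)⁻¹ * ‖v i‖ ^ 2) := by
    have h2 := Real.sum_mul_le_sqrt_mul_sqrt Finset.univ (fun i => √(σ i) * ‖L i‖)
      (fun i => (√(σ i))⁻¹ * ‖v i‖)
    simp only [mul_pow, inv_pow, Real.sq_sqrt (hσ _).le] at h2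
    refine le_of_eq_of_le (Finset.sum_congr rfl fun i _ => ?_) h2
    have := (Real.sqrt_pos.2 (hσ i)).ne'
    field_simp
  have hs1 : 0 ≤ ∑ i, σ i * ‖L i‖ ^ 2 :=
    Finset.sum_nonneg fun i _ => mul_nonneg (hσ i).le (by positivity)
  have hs2 : 0 ≤ ∑ i, (σ i)⁻¹ * ‖v i‖ ^ 2 :=
    Finset.sum_nonneg fun i _ => mul_nonneg (inv_nonneg.2 (hσ i).le) (by positivity)
  have h3 := two_mul_mul_mul_le (k := √(∑ i, σ i * ‖L i‖ ^ 2)) (a := ‖x‖)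
    (b := √(∑ i, (σ i)⁻¹ * ‖v i‖ ^ 2)) hτ one_pos hα (norm_nonneg _) (Real.sqrt_nonneg _)
    (by rwa [Real.sq_sqrt hs1, mul_one])
  rw [Real.sq_sqrt hs2, inv_one, one_mul] at h3
  have h4 : ∑ i, ‖L i‖ * ‖x‖ * ‖v i‖ = ‖x‖ * ∑ i, ‖L i‖ * ‖v i‖ := by
    rw [Finset.mul_sum]; exact Finset.sum_congr rfl fun i _ => by ring
  rw [h4]
  nlinarith [mul_le_mul_of_nonneg_left h1 (norm_nonneg x)]

theorem le_metric_self (hτ : 0 < τ) (hθ₁ : ∀ i, 0 < θ₁ i) (hθ₂ : ∀ i, 0 < θ₂ i)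
    (hγ₁ : ∀ i, 0 < γ₁ i) (hγ₂ : ∀ i, 0 < γ₂ i) (hσ : ∀ i, 0 < σ i) (hα : 0 ≤ α)
    (hL : τ * ∑ i, σ i * ‖L i‖ ^ 2 ≤ α ^ 2) (hK : ∀ i, θ₁ i * γ₁ i * ‖K i‖ ^ 2 ≤ α ^ 2)
    (hM : ∀ i, θ₂ i * γ₂ i * ‖M i‖ ^ 2 ≤ α ^ 2) (w : PrimalDual H X Y G) :
    (1 - α) * (τ⁻¹ * ‖xProj w‖ ^ 2 + ∑ i, ((θ₁ i)⁻¹ * ‖pProj i w‖ ^ 2 +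
      (θ₂ i)⁻¹ * ‖qProj i w‖ ^ 2 + (γ₁ i)⁻¹ * ‖zProj i w‖ ^ 2 + (γ₂ i)⁻¹ * ‖yProj i w‖ ^ 2 +
      (σ i)⁻¹ * ‖vProj i w‖ ^ 2)) ≤ metric L K M τ θ₁ θ₂ γ₁ γ₂ σ w w := by
  have h1 := sum_two_mul_norm_le hτ hσ hα hL (xProj w) (fun i => vProj i w)
  have h2 : ∀ i, -(α * ((θ₁ i)⁻¹ * ‖pProj i w‖ ^ 2 + (γ₁ i)⁻¹ * ‖zProj i w‖ ^ 2)) ≤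
      2 * ⟪K i (zProj i w), pProj i w⟫ := fun i => by
    have h3 := two_mul_mul_mul_le (hθ₁ i) (hγ₁ i) hα (norm_nonneg (pProj i w))
      (norm_nonneg (zProj i w)) (hK i)
    have h4 := neg_le_of_abs_le (abs_real_inner_le_norm (K i (zProj i w)) (pProj i w))
    nlinarith [mul_le_mul_of_nonneg_right ((K i).le_opNorm (zProj i w)) (norm_nonneg (pProj i w))]
  have h3 : ∀ i, -(α * ((θ₂ i)⁻¹ * ‖qProj i w‖ ^ 2 + (γ₂ i)⁻¹ * ‖yProj i w‖ ^ 2)) ≤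
      2 * ⟪M i (yProj i w), qProj i w⟫ := fun i => by
    have h3 := two_mul_mul_mul_le (hθ₂ i) (hγ₂ i) hα (norm_nonneg (qProj i w))
      (norm_nonneg (yProj i w)) (hM i)
    have h4 := neg_le_of_abs_le (abs_real_inner_le_norm (M i (yProj i w)) (qProj i w))
    nlinarith [mul_le_mul_of_nonneg_right ((M i).le_opNorm (yProj i w)) (norm_nonneg (qProj i w))]
  have h4 : ∀ i, ⟪L i (xProj w), vProj i w⟫ ≤ ‖L i‖ * ‖xProj w‖ * ‖vProj i w‖ := fun i =>
    (real_inner_le_norm _ _).trans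
      (mul_le_mul_of_nonneg_right ((L i).le_opNorm _) (norm_nonneg _))
  have h5 := Finset.sum_le_sum fun i (_ : i ∈ Finset.univ) => h2 i
  have h6 := Finset.sum_le_sum fun i (_ : i ∈ Finset.univ) => h3 i
  have h7 := Finset.sum_le_sum fun i (_ : i ∈ Finset.univ) => h4 i
  rw [metric_apply]
  simp only [real_inner_self_eq_norm_sq, real_inner_comm (L _ (xProj w)),
    real_inner_comm (K _ (zProj _ w)), real_inner_comm (M _ (yProj _ w)),
    Finset.sum_add_distrib, Finset.sum_sub_distrib, Finset.sum_neg_distrib, ← Finset.mul_sum,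
    neg_le, mul_add] at *
  linarith

end Positivity

section Step

theorem inv_smul_sub_add_eq_zero {V : Type*} [AddCommGroup V] [Module ℝ V] {γ : ℝ} (hγ : γ ≠ 0)
    {a b c : V} (h : b = a + γ • c) : γ⁻¹ • (a - b) + c = 0 := by
  rw [h, sub_add_cancel_left, smul_neg, inv_smul_smul₀ hγ, neg_add_cancel]

theorem coupled_step_eq {V : Type*} [AddCommGroup V] [Module ℝ V] {γ₁ γ₂ σ : ℝ} (hγ₁ : 0 < γ₁)
    (hγ₂ : 0 < γ₂) (hσ : 0 < σ) {a₁ a₂ b z y v z' y' v' : V}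
    (hz : z' = ((1 + σ * γ₂) / (1 + σ * (γ₁ + γ₂))) • (z + γ₁ • (a₁ + v + σ • b) -
      (σ * γ₁ / (1 + σ * γ₂)) • (y + γ₂ • (a₂ + v + σ • b))))
    (hy : y' = (1 / (1 + σ * γ₂)) • (y + γ₂ • (a₂ + v + σ • b) - (σ * γ₂) • z'))
    (hv : v' = v + σ • (b - z' - y')) :
    γ₁⁻¹ • (z - z') + a₁ + v' = 0 ∧ γ₂⁻¹ • (y - y') + a₂ + v' = 0 ∧
      σ⁻¹ • (v - v') + (b - z' - y') = 0 := by
  have h2 : 1 + σ * γ₂ ≠ 0 := by positivity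
  have h12 : 1 + σ * (γ₁ + γ₂) ≠ 0 := by positivity
  refine ⟨?_, ?_, inv_smul_sub_add_eq_zero hσ.ne' hv⟩
  · rw [add_assoc]
    refine inv_smul_sub_add_eq_zero hγ₁.ne' ?_
    rw [hv, hy, hz]
    clear hz hy hv
    match_scalars <;> field_simp <;> ring
  · rw [add_assoc]
    refine inv_smul_sub_add_eq_zero hγ₂.ne' ?_
    rw [hv, hy]
    clear hz hy hv
    match_scalars <;> field_simp <;> ring

end Step

section Summable

/-- Two sequences are summably close. -/
def Near {E : Type*} [NormedAddCommGroup E] (a b : ℕ → E) : Prop :=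
  Summable fun n => ‖a n - b n‖

namespace Near

variable {E F : Type*} [NormedAddCommGroup E] [NormedSpace ℝ E] [NormedAddCommGroup F]
  [NormedSpace ℝ F] {a b c d : ℕ → E}

omit [NormedSpace ℝ E] in
theorem refl (a : ℕ → E) : Near a a := by simp [Near]

omit [NormedSpace ℝ E] in
theorem trans (h : Near a b) (h' : Near b c) : Near a c :=
  Summable.of_nonneg_of_le (fun _ => norm_nonneg _)
    (fun n => norm_sub_le_norm_sub_add_norm_sub (a n) (b n) (c n)) (Summable.add h h')

omit [NormedSpace ℝ E] in
theorem add (h : Near a b) (h' : Near c d) :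
    Near (fun n => a n + c n) (fun n => b n + d n) :=
  Summable.of_nonneg_of_le (fun _ => norm_nonneg _)
    (fun n => by rw [add_sub_add_comm]; exact norm_add_le _ _) (Summable.add h h')

omit [NormedSpace ℝ E] in
theorem sub (h : Near a b) (h' : Near c d) :
    Near (fun n => a n - c n) (fun n => b n - d n) :=
  Summable.of_nonneg_of_le (fun _ => norm_nonneg _)
    (fun n => by rw [sub_sub_sub_comm]; exact norm_sub_le _ _) (Summable.add h h')

theorem const_smul (t : ℝ) (h : Near a b) : Near (fun n => t • a n) (fun n => t • b n) := by
  simpa only [Near, ← smul_sub, norm_smul] using Summable.mul_left ‖t‖ h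

theorem map (T : E →L[ℝ] F) (h : Near a b) : Near (fun n => T (a n)) (fun n => T (b n)) :=
  Summable.of_nonneg_of_le (fun _ => norm_nonneg _)
    (fun n => by rw [← map_sub]; exact T.le_opNorm _) (Summable.mul_left ‖T‖ h)

end Near

end Summable

section Duality

variable {m : ℕ} {H : Type*} [NormedAddCommGroup H] [InnerProductSpace ℝ H] [CompleteSpace H]
  {G : Fin m → Type*} [∀ i, NormedAddCommGroup (G i)] [∀ i, InnerProductSpace ℝ (G i)]
  [∀ i, CompleteSpace (G i)]
  {X : Fin m → Type*} [∀ i, NormedAddCommGroup (X i)] [∀ i, InnerProductSpace ℝ (X i)]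
  [∀ i, CompleteSpace (X i)]
  {Y : Fin m → Type*} [∀ i, NormedAddCommGroup (Y i)] [∀ i, InnerProductSpace ℝ (Y i)]
  [∀ i, CompleteSpace (Y i)]
  {z : H} {f : H → EReal} {h : H → ℝ} {h' : H → H} {g : ∀ i, X i → EReal}
  {l : ∀ i, Y i → EReal} {r : ∀ i, G i} {L : ∀ i, H →L[ℝ] G i} {K : ∀ i, G i →L[ℝ] X i}
  {M : ∀ i, G i →L[ℝ] Y i} {x : H} {p : ∀ i, X i} {q : ∀ i, Y i} {a b : ∀ i, G i}

theorem einfConv_add_le {E F D : Type*} [NormedAddCommGroup E] [InnerProductSpace ℝ E]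
    [CompleteSpace E] [NormedAddCommGroup F] [InnerProductSpace ℝ F] [CompleteSpace F]
    [NormedAddCommGroup D] [InnerProductSpace ℝ D] [CompleteSpace D]
    {g : E → EReal} {l : F → EReal} {K : D →L[ℝ] E} {M : D →L[ℝ] F} {a b : D} {p : E} {q : F}
    (hp : p ∈ esubdiff g (K a)) (hq : q ∈ esubdiff l (M b)) (hpq : K.adjoint p = M.adjoint q)
    (w : D) :
    einfConv (fun w => g (K w)) (fun w => l (M w)) (a + b) +
      ((⟪K.adjoint p, w - (a + b)⟫ : ℝ) : EReal) ≤
      einfConv (fun w => g (K w)) (fun w => l (M w)) w := by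
  refine le_iInf fun y => ?_
  have h1 : einfConv (fun w => g (K w)) (fun w => l (M w)) (a + b) ≤ g (K a) + l (M b) :=
    (iInf_le _ a).trans (by simp)
  refine (add_le_add_left h1 _).trans ?_
  refine le_trans (le_of_eq ?_) (add_le_add (hp.2.2 (K y)) (hq.2.2 (M (w - y))))
  rw [add_add_add_comm, ← EReal.coe_add, ← map_sub, ← map_sub,
    ← ContinuousLinearMap.adjoint_inner_left, ← ContinuousLinearMap.adjoint_inner_left, hpq,
    ← inner_add_right]
  congr 4
  abel

theorem Pval_le_of_mem_esubdiff (hh : EConvex fun x => (h x : EReal))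
    (hgrad : ∀ x, HasGradientAt h (h' x) x)
    (hx : z - ∑ i, (L i).adjoint ((K i).adjoint (p i)) - h' x ∈ esubdiff f x)
    (hp : ∀ i, p i ∈ esubdiff (g i) (K i (a i))) (hq : ∀ i, q i ∈ esubdiff (l i) (M i (b i)))
    (hpq : ∀ i, (K i).adjoint (p i) = (M i).adjoint (q i))
    (hab : ∀ i, L i x - r i = a i + b i) (x' : H) :
    Pval z f h g l r L K M x ≤ Pval z f h g l r L K M x' := by
  have h1 := hx.2.2 x'
  have h2 := Finset.sum_le_sum fun i (_ : i ∈ Finset.univ) =>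
    einfConv_add_le (hp i) (hq i) (hpq i) (L i x' - r i)
  have h3 : h x - ⟪x, z⟫ + ⟪h' x - z, x' - x⟫ ≤ h x' - ⟪x', z⟫ := by
    have h4 := hh.gradient_le hgrad x x'
    rw [inner_sub_left, inner_sub_right z, real_inner_comm x' z, real_inner_comm x z]
    linarith
  refine le_trans (le_of_eq ?_) (add_le_add (add_le_add h1 h2) (EReal.coe_le_coe_iff.2 h3))
  rw [Finset.sum_add_distrib, ← EReal.coe_real_sum, add_add_add_comm (f x), EReal.coe_add,
    add_add_add_comm (f x + _), ← EReal.coe_add, ← EReal.coe_add]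
  have h5 : ⟪z - ∑ i, (L i).adjoint ((K i).adjoint (p i)) - h' x, x' - x⟫ +
      ∑ i, ⟪(K i).adjoint (p i), L i x' - r i - (a i + b i)⟫ + ⟪h' x - z, x' - x⟫ = 0 := by
    have h6 : ∀ i, ⟪(K i).adjoint (p i), L i x' - r i - (a i + b i)⟫ =
        ⟪(L i).adjoint ((K i).adjoint (p i)), x' - x⟫ := fun i => by
      rw [← hab, sub_sub_sub_cancel_right, ← map_sub,
        ContinuousLinearMap.adjoint_inner_left (L i)]
    rw [Finset.sum_congr rfl fun i _ => h6 i, ← sum_inner, ← inner_add_left, ← inner_add_left]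
    convert inner_zero_left _ using 2
    abel
  rw [h5, EReal.coe_zero, add_zero]
  simp only [Pval, hab]

theorem Dval_le_of_mem_esubdiff (hh : EConvex fun x => (h x : EReal))
    (hgrad : ∀ x, HasGradientAt h (h' x) x)
    (hx : z - ∑ i, (L i).adjoint ((K i).adjoint (p i)) - h' x ∈ esubdiff f x)
    (hp : ∀ i, p i ∈ esubdiff (g i) (K i (a i))) (hq : ∀ i, q i ∈ esubdiff (l i) (M i (b i)))
    (hpq : ∀ i, (K i).adjoint (p i) = (M i).adjoint (q i))
    (hab : ∀ i, L i x - r i = a i + b i) {p' : ∀ i, X i} {q' : ∀ i, Y i}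
    (hpq' : ∀ i, (K i).adjoint (p' i) = (M i).adjoint (q' i)) :
    Dval z f h g l r L K M p' q' ≤ Dval z f h g l r L K M p q := by
  obtain ⟨F, hF⟩ : ∃ F : ℝ, f x = F := ⟨_, (EReal.coe_toReal hx.1 hx.2.1).symm⟩
  have hg : ∀ i, ∃ c : ℝ, g i (K i (a i)) = c := fun i =>
    ⟨_, (EReal.coe_toReal (hp i).1 (hp i).2.1).symm⟩
  have hl : ∀ i, ∃ c : ℝ, l i (M i (b i)) = c := fun i =>
    ⟨_, (EReal.coe_toReal (hq i).1 (hq i).2.1).symm⟩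
  choose c hc using hg
  choose d hd using hl
  have hlin : ∀ (p : ∀ i, X i) (q : ∀ i, Y i), (∀ i, (K i).adjoint (p i) = (M i).adjoint (q i)) →
      ⟪z - ∑ i, (L i).adjoint ((K i).adjoint (p i)), x⟫ - F - h x +
      ∑ i, (⟪p i, K i (a i)⟫ - c i + (⟪q i, M i (b i)⟫ - d i) + ⟪p i, K i (r i)⟫) =
      ⟪z, x⟫ - F - h x - ∑ i, (c i + d i) := by
    intro p q hpq
    have h1 : ∀ i, ⟪p i, K i (a i)⟫ - c i + (⟪q i, M i (b i)⟫ - d i) + ⟪p i, K i (r i)⟫ =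
        ⟪(K i).adjoint (p i), L i x⟫ - (c i + d i) := fun i => by
      rw [← ContinuousLinearMap.adjoint_inner_left, ← ContinuousLinearMap.adjoint_inner_left,
        ← ContinuousLinearMap.adjoint_inner_left, ← hpq, sub_eq_iff_eq_add.1 (hab i),
        inner_add_right, inner_add_right]
      ring
    simp only [h1, Finset.sum_sub_distrib, inner_sub_left, sum_inner,
      ContinuousLinearMap.adjoint_inner_left]
    ring
  have hsubh : h' x ∈ esubdiff (fun x => (h x : EReal)) x :=
    ⟨EReal.coe_ne_top _, EReal.coe_ne_bot _, fun y => by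
      beta_reduce
      exact_mod_cast hh.gradient_le hgrad x y⟩
  calc Dval z f h g l r L K M p' q'
      ≤ -((⟪z - ∑ i, (L i).adjoint ((K i).adjoint (p' i)), x⟫ - F - h x : ℝ) : EReal) -
        ((∑ i, (⟪p' i, K i (a i)⟫ - c i + (⟪q' i, M i (b i)⟫ - d i) + ⟪p' i, K i (r i)⟫) : ℝ) :
          EReal) := by
        refine EReal.sub_le_sub (EReal.neg_le_neg_iff.2 (le_iInf fun y => ?_)) ?_
        · have h1 := inner_sub_le_econj (f := f) y x
          have h2 := inner_sub_le_econj (f := fun x => (h x : EReal))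
            (z - ∑ i, (L i).adjoint ((K i).adjoint (p' i)) - y) x
          rw [hF] at h1
          refine le_trans (le_of_eq ?_) (add_le_add h1 h2)
          rw [inner_sub_left _ y]
          norm_cast
          ring
        · rw [EReal.coe_real_sum]
          refine Finset.sum_le_sum fun i _ => ?_
          have h1 := inner_sub_le_econj (f := g i) (p' i) (K i (a i))
          have h2 := inner_sub_le_econj (f := l i) (q' i) (M i (b i))
          rw [hc] at h1
          rw [hd] at h2
          rw [EReal.coe_add, EReal.coe_add]
          exact add_le_add_left (add_le_add h1 h2) _
    _ = -((⟪z - ∑ i, (L i).adjoint ((K i).adjoint (p i)), x⟫ - F - h x : ℝ) : EReal) -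
        ((∑ i, (⟪p i, K i (a i)⟫ - c i + (⟪q i, M i (b i)⟫ - d i) + ⟪p i, K i (r i)⟫) : ℝ) :
          EReal) := by
        norm_cast
        linarith [hlin p q hpq, hlin p' q' hpq']
    _ ≤ Dval z f h g l r L K M p q := by
        refine EReal.sub_le_sub (EReal.neg_le_neg_iff.2 ?_) (le_of_eq ?_)
        · refine (iInf_le _ (z - ∑ i, (L i).adjoint ((K i).adjoint (p i)) - h' x)).trans ?_
          rw [sub_sub_cancel, econj_eq_of_mem_esubdiff hx, econj_eq_of_mem_esubdiff hsubh, hF,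
            inner_sub_left _ (h' x)]
          norm_cast
          linarith
        · rw [EReal.coe_real_sum]
          refine Finset.sum_congr rfl fun i _ => ?_
          rw [econj_eq_of_mem_esubdiff (hp i), econj_eq_of_mem_esubdiff (hq i), hc, hd]
          norm_cast

end Duality

section Iteration

variable {ι : Type*} [Fintype ι]
  {H : Type*} [NormedAddCommGroup H] [InnerProductSpace ℝ H] [CompleteSpace H]
  {G : ι → Type*} [∀ i, NormedAddCommGroup (G i)] [∀ i, InnerProductSpace ℝ (G i)]
  [∀ i, CompleteSpace (G i)]
  {X : ι → Type*} [∀ i, NormedAddCommGroup (X i)] [∀ i, InnerProductSpace ℝ (X i)]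
  [∀ i, CompleteSpace (X i)]
  {Y : ι → Type*} [∀ i, NormedAddCommGroup (Y i)] [∀ i, InnerProductSpace ℝ (Y i)]
  [∀ i, CompleteSpace (Y i)]
  {L : ∀ i, H →L[ℝ] G i} {K : ∀ i, G i →L[ℝ] X i} {M : ∀ i, G i →L[ℝ] Y i}
  {z : H} {r : ∀ i, G i} {τ : ℝ} {θ₁ θ₂ γ₁ γ₂ σ : ι → ℝ} {f : H → EReal} {g : ∀ i, X i → EReal}
  {l : ∀ i, Y i → EReal} {h' : H → H}

theorem weakLsc_nonsmooth (hf : ProperConvLsc f) (hg : ∀ i x, econj (g i) x ≠ ⊥)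
    (hl : ∀ i x, econj (l i) x ≠ ⊥) :
    WeakLsc (nonsmooth f g l : PrimalDual H X Y G → EReal) := by
  have hb : ∀ i (w : PrimalDual H X Y G), econj (g i) (pProj i w) + econj (l i) (qProj i w) ≠ ⊥ :=
    fun i w => by rw [Ne, EReal.add_eq_bot_iff, not_or]; exact ⟨hg _ _, hl _ _⟩
  exact WeakLsc.add (hf.weakLsc.comp xProj)
    (WeakLsc.sum _ (fun i => WeakLsc.add ((weakLsc_econj (g i)).comp (pProj i))
      ((weakLsc_econj (l i)).comp (qProj i)) (fun _ => hg i _) fun _ => hl i _) hb)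
    (fun _ => hf.2.1 _) fun w => EReal.sum_ne_bot _ fun i => hb i w

theorem inv_smul_add_smul_sub {V : Type*} [AddCommGroup V] [Module ℝ V] {γ : ℝ} (hγ : γ ≠ 0)
    (a b c : V) : γ⁻¹ • (a + γ • c - b) = γ⁻¹ • (a - b) + c := by
  rw [add_sub_right_comm, smul_add, inv_smul_smul₀ hγ]

theorem IsProx.mem_esubdiff_econj {E : Type*} [NormedAddCommGroup E] [InnerProductSpace ℝ E]
    [CompleteSpace E] {φ : E → EReal} (hφ : ProperConvLsc φ) {θ : ℝ} (hθ : 0 < θ) {a b j : E}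
    (hj : IsProx θ (econj φ) (a + θ • b) j) : θ⁻¹ • (a - j) + b ∈ esubdiff (econj φ) j := by
  rw [← inv_smul_add_smul_sub hθ.ne']
  exact IsProx.mem_esubdiff (eConvex_econj hφ.2.1) (econj_ne_bot hφ.1) hφ.exists_econj_ne_top hθ hj

theorem isFBStep_of_isProx (hf : ProperConvLsc f) (hg : ∀ i, ProperConvLsc (g i))
    (hl : ∀ i, ProperConvLsc (l i)) (hτ : 0 < τ) (hθ₁ : ∀ i, 0 < θ₁ i) (hθ₂ : ∀ i, 0 < θ₂ i)
    (hγ₁ : ∀ i, 0 < γ₁ i) (hγ₂ : ∀ i, 0 < γ₂ i) (hσ : ∀ i, 0 < σ i) {w s : PrimalDual H X Y G}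
    (hx : IsProx τ f (xProj w - τ • (h' (xProj w) + ∑ i, (L i).adjoint (vProj i w) - z)) (xProj s))
    (hp : ∀ i, IsProx (θ₁ i) (econj (g i)) (pProj i w + θ₁ i • K i (zProj i w)) (pProj i s))
    (hq : ∀ i, IsProx (θ₂ i) (econj (l i)) (qProj i w + θ₂ i • M i (yProj i w)) (qProj i s))
    (hz : ∀ i, zProj i s = ((1 + σ i * γ₂ i) / (1 + σ i * (γ₁ i + γ₂ i))) •
      (zProj i w + γ₁ i • ((K i).adjoint (pProj i w - (2 : ℝ) • pProj i s) + vProj i w +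
        σ i • (L i ((2 : ℝ) • xProj s - xProj w) - r i)) -
      (σ i * γ₁ i / (1 + σ i * γ₂ i)) •
        (yProj i w + γ₂ i • ((M i).adjoint (qProj i w - (2 : ℝ) • qProj i s) + vProj i w +
          σ i • (L i ((2 : ℝ) • xProj s - xProj w) - r i)))))
    (hy : ∀ i, yProj i s = (1 / (1 + σ i * γ₂ i)) •
      (yProj i w + γ₂ i • ((M i).adjoint (qProj i w - (2 : ℝ) • qProj i s) + vProj i w +
        σ i • (L i ((2 : ℝ) • xProj s - xProj w) - r i)) - (σ i * γ₂ i) • zProj i s))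
    (hv : ∀ i, vProj i s = vProj i w +
      σ i • (L i ((2 : ℝ) • xProj s - xProj w) - r i - zProj i s - yProj i s)) :
    IsFBStep (nonsmooth f g l) (metric L K M τ θ₁ θ₂ γ₁ γ₂ σ) (skew L K M) (linForm z r)
      xProj h' w s := by
  have h1 := fun i => coupled_step_eq (hγ₁ i) (hγ₂ i) (hσ i) (hz i) (hy i) (hv i)
  refine isFBStep_of_mem_esubdiff ?_ (fun i => IsProx.mem_esubdiff_econj (hg i) (hθ₁ i) (hp i))
    (fun i => IsProx.mem_esubdiff_econj (hl i) (hθ₂ i) (hq i))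
    (fun i => (h1 i).1) (fun i => (h1 i).2.1) fun i => (h1 i).2.2
  have h2 := IsProx.mem_esubdiff hf.eConvex hf.2.1 hf.1 hτ hx
  rw [sub_eq_add_neg (xProj w), ← smul_neg, inv_smul_add_smul_sub hτ.ne'] at h2
  convert h2 using 1
  abel

theorem exists_isFBStep_self
    (hran : ∃ (x : H) (u : H) (w : ∀ i, G i), u ∈ esubdiff f x ∧
      (∀ i, w i ∈ parOp (compOp (K i) (esubdiff (g i))) (compOp (M i) (esubdiff (l i)))
        (L i x - r i)) ∧
      z = u + ∑ i, (L i).adjoint (w i) + h' x) :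
    ∃ s, IsFBStep (nonsmooth f g l) (metric L K M τ θ₁ θ₂ γ₁ γ₂ σ) (skew L K M) (linForm z r)
      xProj h' s s := by
  obtain ⟨x, u, w, hu, hw, rfl⟩ := hran
  have h1 : ∀ i, ∃ (a b : G i) (p : X i) (q : Y i), p ∈ esubdiff (g i) (K i a) ∧
      q ∈ esubdiff (l i) (M i b) ∧ (K i).adjoint p = w i ∧ (M i).adjoint q = w i ∧
      L i x - r i = a + b := fun i => by
    obtain ⟨a, ⟨p, hp, hpw⟩, b, ⟨q, hq, hqw⟩, hab⟩ := hw i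
    exact ⟨a, b, p, q, hp, hq, hpw, hqw, hab⟩
  choose a b p q hp hq hpw hqw hab using h1
  refine ⟨mk x p q a b w, isFBStep_of_mem_esubdiff ?_ (fun i => ?_) (fun i => ?_) (fun i => ?_)
    (fun i => ?_) fun i => ?_⟩
  · change τ⁻¹ • (x - x) - ∑ i, (L i).adjoint (w i) - h' x + _ ∈ esubdiff f x
    convert hu using 1
    rw [sub_self, smul_zero]
    abel
  · simpa using mem_esubdiff_econj (hp i)
  · simpa using mem_esubdiff_econj (hq i)
  · simp [two_smul, hpw]
  · simp [two_smul, hqw]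
  · simp [two_smul, hab]

omit [CompleteSpace H] [∀ i, CompleteSpace (G i)] [∀ i, CompleteSpace (X i)]
  [∀ i, CompleteSpace (Y i)] in
theorem summable_norm_sub {a b : ℕ → PrimalDual H X Y G}
    (hx : Near (fun n => xProj (a n)) fun n => xProj (b n))
    (hp : ∀ i, Near (fun n => pProj i (a n)) fun n => pProj i (b n))
    (hq : ∀ i, Near (fun n => qProj i (a n)) fun n => qProj i (b n))
    (hz : ∀ i, Near (fun n => zProj i (a n)) fun n => zProj i (b n))
    (hy : ∀ i, Near (fun n => yProj i (a n)) fun n => yProj i (b n))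
    (hv : ∀ i, Near (fun n => vProj i (a n)) fun n => vProj i (b n)) :
    Summable fun n => ‖a n - b n‖ := by
  refine Summable.of_nonneg_of_le (fun _ => norm_nonneg _) (fun n => norm_le _) ?_
  simp only [map_sub]
  exact Summable.add hx (summable_sum fun i _ =>
    (((Summable.add (hp i) (hq i)).add (hz i)).add (hy i)).add (hv i))

omit [CompleteSpace H] [∀ i, CompleteSpace (G i)] [∀ i, CompleteSpace (X i)]
  [∀ i, CompleteSpace (Y i)] in
/-- A lower bound on the weighted norm that is uniform in the components. -/
theorem mul_norm_sq_le_metric {c α : ℝ} (hτ : 0 < τ) (hθ₁ : ∀ i, 0 < θ₁ i)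
    (hθ₂ : ∀ i, 0 < θ₂ i) (hγ₁ : ∀ i, 0 < γ₁ i) (hγ₂ : ∀ i, 0 < γ₂ i) (hσ : ∀ i, 0 < σ i)
    (hα : 0 ≤ α) (hL : τ * ∑ i, σ i * ‖L i‖ ^ 2 ≤ α ^ 2)
    (hK : ∀ i, θ₁ i * γ₁ i * ‖K i‖ ^ 2 ≤ α ^ 2) (hM : ∀ i, θ₂ i * γ₂ i * ‖M i‖ ^ 2 ≤ α ^ 2)
    (hcτ : c ≤ (1 - α) * τ⁻¹) (hcθ₁ : ∀ i, c ≤ (1 - α) * (θ₁ i)⁻¹)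
    (hcθ₂ : ∀ i, c ≤ (1 - α) * (θ₂ i)⁻¹) (hcγ₁ : ∀ i, c ≤ (1 - α) * (γ₁ i)⁻¹)
    (hcγ₂ : ∀ i, c ≤ (1 - α) * (γ₂ i)⁻¹) (hcσ : ∀ i, c ≤ (1 - α) * (σ i)⁻¹)
    (w : PrimalDual H X Y G) : c * ‖w‖ ^ 2 ≤ metric L K M τ θ₁ θ₂ γ₁ γ₂ σ w w := by
  refine le_trans ?_ (le_metric_self hτ hθ₁ hθ₂ hγ₁ hγ₂ hσ hα hL hK hM w)
  rw [norm_sq_eq, mul_add, mul_add, Finset.mul_sum, Finset.mul_sum, ← mul_assoc]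
  simp only [mul_add, ← mul_assoc]
  gcongr with i
  exacts [hcθ₁ i, hcθ₂ i, hcγ₁ i, hcγ₂ i, hcσ i]

end Iteration

end PrimalDual

theorem stmt13 {m : ℕ}
    {H : Type*} [NormedAddCommGroup H] [InnerProductSpace ℝ H] [CompleteSpace H]
    {G : Fin m → Type*} [∀ i, NormedAddCommGroup (G i)] [∀ i, InnerProductSpace ℝ (G i)]
    [∀ i, CompleteSpace (G i)]
    {X : Fin m → Type*} [∀ i, NormedAddCommGroup (X i)] [∀ i, InnerProductSpace ℝ (X i)]
    [∀ i, CompleteSpace (X i)]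
    {Y : Fin m → Type*} [∀ i, NormedAddCommGroup (Y i)] [∀ i, InnerProductSpace ℝ (Y i)]
    [∀ i, CompleteSpace (Y i)]
    (z : H)
    (f : H → EReal) (hf : ProperConvLsc f)
    (μ : ℝ) (hμ : 0 < μ)
    (h : H → ℝ) (hh : ProperConvLsc (fun x => (h x : EReal)))
    (h' : H → H) (hgrad : ∀ x, HasGradientAt h (h' x) x)
    (hlip : ∀ x y : H, ‖h' x - h' y‖ ≤ μ * ‖x - y‖)
    (r : ∀ i, G i)
    (g : ∀ i, X i → EReal) (hg : ∀ i, ProperConvLsc (g i))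
    (l : ∀ i, Y i → EReal) (hl : ∀ i, ProperConvLsc (l i))
    (L : ∀ i, H →L[ℝ] G i) (hL : ∀ i, L i ≠ 0)
    (K : ∀ i, G i →L[ℝ] X i) (hK : ∀ i, K i ≠ 0)
    (M : ∀ i, G i →L[ℝ] Y i) (hM : ∀ i, M i ≠ 0)
    -- range condition
    (hran : ∃ (x : H) (u : H) (w : ∀ i, G i), u ∈ esubdiff f x ∧
        (∀ i, w i ∈ parOp (compOp (K i) (esubdiff (g i))) (compOp (M i) (esubdiff (l i)))
          (L i x - r i)) ∧
        z = u + ∑ i, ContinuousLinearMap.adjoint (L i) (w i) + h' x)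
    -- step sizes
    (τ : ℝ) (hτ : 0 < τ)
    (θ1 θ2 γ1 γ2 σ : Fin m → ℝ)
    (hθ1 : ∀ i, 0 < θ1 i) (hθ2 : ∀ i, 0 < θ2 i)
    (hγ1 : ∀ i, 0 < γ1 i) (hγ2 : ∀ i, 0 < γ2 i) (hσ : ∀ i, 0 < σ i)
    (α : ℝ)
    (hα : IsGreatest ({Real.sqrt (τ * ∑ i, σ i * ‖L i‖ ^ 2)} ∪
        Set.range (fun j => Real.sqrt (θ1 j * γ1 j * ‖K j‖ ^ 2)) ∪
        Set.range (fun j => Real.sqrt (θ2 j * γ2 j * ‖M j‖ ^ 2))) α)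
    -- `2 μ⁻¹ (1 - α) · min{1/τ, 1/θ1ᵢ, 1/θ2ᵢ, 1/γ1ᵢ, 1/γ2ᵢ, 1/σᵢ} > 1`
    (hstep : 1 < 2 * μ⁻¹ * (1 - α) * (1 / τ) ∧ ∀ i,
        1 < 2 * μ⁻¹ * (1 - α) * (1 / θ1 i) ∧ 1 < 2 * μ⁻¹ * (1 - α) * (1 / θ2 i) ∧
        1 < 2 * μ⁻¹ * (1 - α) * (1 / γ1 i) ∧ 1 < 2 * μ⁻¹ * (1 - α) * (1 / γ2 i) ∧
        1 < 2 * μ⁻¹ * (1 - α) * (1 / σ i))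
    -- relaxation parameters
    (ε : ℝ) (hε : ε ∈ Set.Ioo (0:ℝ) 1) (lam : ℕ → ℝ) (hlam : ∀ n, lam n ∈ Set.Icc ε 1)
    -- the sequences generated by Algorithm 4.3
    (x xt : ℕ → H)
    (p pt : ℕ → ∀ i, X i) (q qt : ℕ → ∀ i, Y i)
    (zz zt y yt v vt u1 u2 : ℕ → ∀ i, G i)
    (hxt : ∃ j : ℕ → H,
      (∀ n, IsProx τ f
        (x n - τ • (h' (x n) + ∑ i, ContinuousLinearMap.adjoint (L i) (v n i) - z)) (j n)) ∧
      Summable (fun n => ‖xt n - j n‖))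
    (hpt : ∀ i, ∃ j : ℕ → X i,
      (∀ n, IsProx (θ1 i) (econj (g i)) (p n i + θ1 i • K i (zz n i)) (j n)) ∧
      Summable (fun n => ‖pt n i - j n‖))
    (hqt : ∀ i, ∃ j : ℕ → Y i,
      (∀ n, IsProx (θ2 i) (econj (l i)) (q n i + θ2 i • M i (y n i)) (j n)) ∧
      Summable (fun n => ‖qt n i - j n‖))
    (hu1 : ∀ i, Summable (fun n => ‖u1 n i - (zz n i + γ1 i •
        (ContinuousLinearMap.adjoint (K i) (p n i - (2:ℝ) • pt n i) + v n i +
          σ i • (L i ((2:ℝ) • xt n - x n) - r i)))‖))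
    (hu2 : ∀ i, Summable (fun n => ‖u2 n i - (y n i + γ2 i •
        (ContinuousLinearMap.adjoint (M i) (q n i - (2:ℝ) • qt n i) + v n i +
          σ i • (L i ((2:ℝ) • xt n - x n) - r i)))‖))
    (hzt : ∀ i, Summable (fun n => ‖zt n i -
        ((1 + σ i * γ2 i) / (1 + σ i * (γ1 i + γ2 i))) •
          (u1 n i - (σ i * γ1 i / (1 + σ i * γ2 i)) • u2 n i)‖))
    (hyt : ∀ i, Summable (fun n => ‖yt n i -
        (1 / (1 + σ i * γ2 i)) • (u2 n i - (σ i * γ2 i) • zt n i)‖))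
    (hvt : ∀ i, Summable (fun n => ‖vt n i -
        (v n i + σ i • (L i ((2:ℝ) • xt n - x n) - r i - zt n i - yt n i))‖))
    (hx : ∀ n, x (n+1) = x n + lam n • (xt n - x n))
    (hp : ∀ n i, p (n+1) i = p n i + lam n • (pt n i - p n i))
    (hq : ∀ n i, q (n+1) i = q n i + lam n • (qt n i - q n i))
    (hz : ∀ n i, zz (n+1) i = zz n i + lam n • (zt n i - zz n i))
    (hy : ∀ n i, y (n+1) i = y n i + lam n • (yt n i - y n i))
    (hv : ∀ n i, v (n+1) i = v n i + lam n • (vt n i - v n i))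
    :
    ∃ (xb : H) (pb : ∀ i, X i) (qb : ∀ i, Y i),
      (∀ x' : H, Pval z f h g l r L K M xb ≤ Pval z f h g l r L K M x') ∧
      (∀ i, ContinuousLinearMap.adjoint (K i) (pb i) =
          ContinuousLinearMap.adjoint (M i) (qb i)) ∧
      (∀ (p' : ∀ i, X i) (q' : ∀ i, Y i),
        (∀ i, ContinuousLinearMap.adjoint (K i) (p' i) =
          ContinuousLinearMap.adjoint (M i) (q' i)) →
        Dval z f h g l r L K M p' q' ≤ Dval z f h g l r L K M pb qb) ∧
      WConv x xb ∧
      (∀ i, WConv (fun n => p n i) (pb i)) ∧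
      (∀ i, WConv (fun n => q n i) (qb i)) := by
  have hα0 : 0 ≤ α :=
    (Real.sqrt_nonneg _).trans (hα.2 (Or.inl (Or.inl rfl)))
  have hαL : τ * ∑ i, σ i * ‖L i‖ ^ 2 ≤ α ^ 2 :=
    (Real.sqrt_le_left hα0).1 (hα.2 (Or.inl (Or.inl rfl)))
  have hαK : ∀ i, θ1 i * γ1 i * ‖K i‖ ^ 2 ≤ α ^ 2 := fun i =>
    (Real.sqrt_le_left hα0).1 (hα.2 (Or.inl (Or.inr ⟨i, rfl⟩)))
  have hαM : ∀ i, θ2 i * γ2 i * ‖M i‖ ^ 2 ≤ α ^ 2 := fun i =>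
    (Real.sqrt_le_left hα0).1 (hα.2 (Or.inr ⟨i, rfl⟩))
  have hlt : ∀ {t : ℝ}, 1 < 2 * μ⁻¹ * (1 - α) * (1 / t) → μ < 2 * ((1 - α) * t⁻¹) := by
    intro t ht
    have h1 := mul_lt_mul_of_pos_left ht hμ
    rw [mul_one, one_div] at h1
    exact h1.trans_eq (by field_simp)
  have hle : ∀ {t : ℝ}, 1 < 2 * μ⁻¹ * (1 - α) * (1 / t) → μ / 2 ≤ (1 - α) * t⁻¹ := fun ht => by
    linarith [hlt ht]
  have hgb : ∀ i x, econj (g i) x ≠ ⊥ := fun i => econj_ne_bot (hg i).1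
  have hlb : ∀ i x, econj (l i) x ≠ ⊥ := fun i => econj_ne_bot (hl i).1
  have hα1 : 0 ≤ 1 - α := by
    have h1 := hlt hstep.1
    by_contra! h2
    nlinarith [mul_neg_of_neg_of_pos h2 (inv_pos.2 hτ)]
  obtain ⟨jx, hjx, hjx'⟩ := hxt
  choose jp hjp hjp' using hpt
  choose jq hjq hjq' using hqt
  let b : ℕ → ∀ i, G i := fun n i => L i ((2 : ℝ) • jx n - x n) - r i
  let c1 : ℕ → ∀ i, G i := fun n i => zz n i + γ1 i •
    ((K i).adjoint (p n i - (2 : ℝ) • jp i n) + v n i + σ i • b n i)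
  let c2 : ℕ → ∀ i, G i := fun n i => y n i + γ2 i •
    ((M i).adjoint (q n i - (2 : ℝ) • jq i n) + v n i + σ i • b n i)
  let jz : ℕ → ∀ i, G i := fun n i => ((1 + σ i * γ2 i) / (1 + σ i * (γ1 i + γ2 i))) •
    (c1 n i - (σ i * γ1 i / (1 + σ i * γ2 i)) • c2 n i)
  let jy : ℕ → ∀ i, G i := fun n i => (1 / (1 + σ i * γ2 i)) • (c2 n i - (σ i * γ2 i) • jz n i)
  let jv : ℕ → ∀ i, G i := fun n i => v n i + σ i • (b n i - jz n i - jy n i)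
  have hb : ∀ i, PrimalDual.Near (fun n => L i ((2 : ℝ) • xt n - x n) - r i) fun n => b n i :=
    fun i => (((PrimalDual.Near.const_smul 2 hjx').sub (.refl x)).map (L i)).sub (.refl _)
  have hc1 : ∀ i, PrimalDual.Near (fun n => u1 n i) fun n => c1 n i := fun i =>
    .trans (hu1 i) (.add (.refl _) (.const_smul _ (.add (.add (.map _ (.sub (.refl _)
      (.const_smul 2 (hjp' i)))) (.refl _)) (.const_smul _ (hb i)))))
  have hc2 : ∀ i, PrimalDual.Near (fun n => u2 n i) fun n => c2 n i := fun i =>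
    .trans (hu2 i) (.add (.refl _) (.const_smul _ (.add (.add (.map _ (.sub (.refl _)
      (.const_smul 2 (hjq' i)))) (.refl _)) (.const_smul _ (hb i)))))
  have hjz : ∀ i, PrimalDual.Near (fun n => zt n i) fun n => jz n i := fun i =>
    .trans (hzt i) (.const_smul _ (.sub (hc1 i) (.const_smul _ (hc2 i))))
  have hjy : ∀ i, PrimalDual.Near (fun n => yt n i) fun n => jy n i := fun i =>
    .trans (hyt i) (.const_smul _ (.sub (hc2 i) (.const_smul _ (hjz i))))
  have hjv : ∀ i, PrimalDual.Near (fun n => vt n i) fun n => jv n i := fun i =>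
    .trans (hvt i) (.add (.refl _) (.const_smul _ (.sub (.sub (hb i) (hjz i)) (hjy i))))
  obtain ⟨s, hs, hws⟩ := exists_weakTendsto_of_forwardBackward
    (F := PrimalDual.nonsmooth f g l) (B := PrimalDual.metric L K M τ θ1 θ2 γ1 γ2 σ)
    (S := PrimalDual.skew L K M) (c := PrimalDual.linForm z r) (P := PrimalDual.xProj) (C := h')
    (μ := μ) (κ := μ / 2) (ρ := (1 - α) * τ⁻¹)
    (w := fun n => PrimalDual.mk (x n) (p n) (q n) (zz n) (y n) (v n))
    (wt := fun n => PrimalDual.mk (xt n) (pt n) (qt n) (zt n) (yt n) (vt n))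
    (v := fun n => PrimalDual.mk (jx n) (fun i => jp i n) (fun i => jq i n) (jz n) (jy n) (jv n))
    (PrimalDual.nonsmooth_ne_bot hf.2.1 hgb hlb) (PrimalDual.weakLsc_nonsmooth hf hgb hlb)
    (PrimalDual.skew_comm L K M) (PrimalDual.metric_comm L K M τ θ1 θ2 γ1 γ2 σ) hμ
    (cocoercive_of_lipschitz_gradient hμ hh.eConvex hgrad hlip) (half_pos hμ)
    (PrimalDual.mul_norm_sq_le_metric hτ hθ1 hθ2 hγ1 hγ2 hσ hα0 hαL hαK hαM (hle hstep.1)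
      (fun i => hle (hstep.2 i).1) (fun i => hle (hstep.2 i).2.1)
      (fun i => hle (hstep.2 i).2.2.1) (fun i => hle (hstep.2 i).2.2.2.1)
      fun i => hle (hstep.2 i).2.2.2.2)
    (hlt hstep.1)
    (fun a => by
      refine le_trans ?_
        (PrimalDual.le_metric_self hτ hθ1 hθ2 hγ1 hγ2 hσ hα0 hαL hαK hαM a)
      rw [mul_assoc]
      refine mul_le_mul_of_nonneg_left (le_add_of_nonneg_right ?_) hα1
      refine Finset.sum_nonneg fun i _ => ?_
      have := hθ1 i
      have := hθ2 i
      have := hγ1 i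
      have := hγ2 i
      have := hσ i
      positivity)
    (PrimalDual.exists_isFBStep_self hran)
    (fun n => PrimalDual.isFBStep_of_isProx hf hg hl hτ hθ1 hθ2 hγ1 hγ2 hσ (hjx n)
      (fun i => hjp i n) (fun i => hjq i n) (fun _ => rfl) (fun _ => rfl) fun _ => rfl)
    (PrimalDual.summable_norm_sub hjx' hjp' hjq' hjz hjy hjv) hε.1 hlam
    (fun n => PrimalDual.ext_proj (by simp [hx]) fun i => by simp [hp, hq, hz, hy, hv])
  obtain ⟨hsx, hsi⟩ := PrimalDual.optimality_of_isFBStep hf.2.1 hgb hlb hs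
  have hKM : ∀ i, (K i).adjoint (PrimalDual.pProj i s) = (M i).adjoint (PrimalDual.qProj i s) :=
    fun i => (hsi i).2.2.1.trans (hsi i).2.2.2.1.symm
  have hgs := fun i => (hg i).mem_esubdiff_of_econj (hsi i).1
  have hls := fun i => (hl i).mem_esubdiff_of_econj (hsi i).2.1
  simp only [← (hsi _).2.2.1] at hsx
  exact ⟨PrimalDual.xProj s, fun i => PrimalDual.pProj i s, fun i => PrimalDual.qProj i s,
    PrimalDual.Pval_le_of_mem_esubdiff hh.eConvex hgrad hsx hgs hls hKM fun i =>
      (hsi i).2.2.2.2,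
    hKM,
    fun p' q' hpq' => PrimalDual.Dval_le_of_mem_esubdiff hh.eConvex hgrad hsx hgs hls hKM
      (fun i => (hsi i).2.2.2.2) hpq',
    hws.map PrimalDual.xProj, fun i => hws.map (PrimalDual.pProj i),
    fun i => hws.map (PrimalDual.qProj i)⟩
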